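/- Let n ≥ 1 and let λ ∈ ℤⁿ with λ₁ ≥ … ≥ λₙ ≥ 0. Then in the type GL_n affine Hecke algebra H, 1₀ X^λ 1₀ = W_λ(t) Σ_{T ∈ B(λ)} ψ_T X^T 1₀, where the sum is over all semistandard Young tableaux T of shape λ with entries in [n], ψ_T is Macdonald's tableau statistic, W_λ(t) = Σ_{w ∈ S_{n,λ}} t^{ℓ(w)}, 1₀ = Σ_{w∈S_n} T_w, and X^T = Π_{i=1}^n X_i^{c_i} with c_i the number of entries equal to i in T. Equivalently, the Hall–Littlewood polynomial P_λ(t), defined by P_λ(t) 1₀ = (1/W_λ(t)) 1₀ X^λ 1₀, satisfies P_λ(t) = Σ_{T ∈ B(λ)} ψ_T X^T. -/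

import Mathlib

set_option maxHeartbeats 1000000

attribute [local instance] Classical.propDecidable

noncomputable section

namespace HLHecke

/-- The base ring `ℤ[t^{±1}]` of Laurent polynomials. -/
abbrev HR : Type := LaurentPolynomial ℤ

/-- The parameter `t`. -/
def tt : HR := LaurentPolynomial.T 1

/-! ### The symmetric group on `Fin n` -/

/-- The simple transposition `s_j = (j, j+1)` (junk value `1` if out of range). -/
def sgen (n : ℕ) (j : ℕ) : Equiv.Perm (Fin n) :=
  if h : j + 1 < n then Equiv.swap ⟨j, Nat.lt_of_succ_lt h⟩ ⟨j + 1, h⟩ else 1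

/-- The product `s_{i₁} ⋯ s_{i_ℓ}` of a word `l = [i₁, …, i_ℓ]`. -/
def wordProd (n : ℕ) (l : List ℕ) : Equiv.Perm (Fin n) := (l.map (sgen n)).prod

/-- The action of `S_n` on `ℤⁿ` by permutation of coordinates. -/
def wAct (n : ℕ) (w : Equiv.Perm (Fin n)) (μ : Fin n → ℤ) : Fin n → ℤ := fun i => μ (w⁻¹ i)

/-- The standard inner product on `ℤⁿ`. -/
def ip (n : ℕ) (μ ν : Fin n → ℤ) : ℤ := ∑ i, μ i * ν i

/-- The standard basis vector `ε_i`. -/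
def eps (n : ℕ) (i : Fin n) : Fin n → ℤ := fun k => if k = i then 1 else 0

/-- The simple root `α_j = ε_j − ε_{j+1}` (0-indexed: entries `j` and `j+1` of `Fin n`). -/
def alpha (n : ℕ) (j : ℕ) : Fin n → ℤ :=
  fun i => if (i : ℕ) = j then 1 else if (i : ℕ) = j + 1 then -1 else 0

/-- The fundamental weight `ϖ_k = ε₁ + … + ε_k`. -/
def varpi (n : ℕ) (k : ℕ) : Fin n → ℤ := fun i => if (i : ℕ) < k then 1 else 0

/-- The set of positive roots `R₊`. -/
def Rpos (n : ℕ) (β : Fin n → ℤ) : Prop := ∃ i j : Fin n, i < j ∧ β = eps n i - eps n j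

/-- The Coxeter length: minimal length of a word in the simple transpositions. -/
def len (n : ℕ) (w : Equiv.Perm (Fin n)) : ℕ :=
  sInf {k | ∃ l : List ℕ, (∀ j ∈ l, j + 1 < n) ∧ l.length = k ∧ wordProd n l = w}

/-- A choice of reduced word for `w`. -/
def redWord (n : ℕ) (w : Equiv.Perm (Fin n)) : List ℕ :=
  if h : ∃ l : List ℕ, (∀ j ∈ l, j + 1 < n) ∧ l.length = len n w ∧ wordProd n l = w
  then h.choose else []

/-! ### Columns -/

lemma col_card_le (n : ℕ) (C : Finset (Fin n)) : C.card ≤ n := by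
  simpa using Finset.card_le_univ C

/-- The minimal length coset representative `u_C` attached to a column `C`:
it sends `1, …, ℓ` to the entries of `C` in increasing order and `ℓ+1, …, n` to the
entries of the complement of `C` in increasing order. -/
def colPerm (n : ℕ) (C : Finset (Fin n)) : Equiv.Perm (Fin n) :=
  ((finCongr ((Nat.add_sub_cancel' (col_card_le n C)).symm)).trans
    finSumFinEquiv.symm).trans <|
  ((Equiv.sumCongr (C.orderIsoOfFin rfl).toEquiv
      ((Cᶜ.orderIsoOfFin (by simp [Finset.card_compl])).toEquiv)).trans <|
    (Equiv.sumCongr (Equiv.refl _) (Equiv.subtypeEquivRight (fun x => Finset.mem_compl))).trans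
      (Equiv.sumCompl (fun x => x ∈ C)))

/-- The `k`-th smallest entry of a column (0-indexed, as a natural number; junk `0` if
out of range). -/
def nth (n : ℕ) (C : Finset (Fin n)) (k : ℕ) : ℕ := ((C.sort (· ≤ ·)).map Fin.val).getD k 0

/-- The action of the simple transposition `s_j` on columns. -/
def sCol (n : ℕ) (j : ℕ) (C : Finset (Fin n)) : Finset (Fin n) := C.image (sgen n j)

/-- Semistandardness of the two-column filling `F ⊗ E` (`F` the left column):
entrywise `f_i ≤ e_i`. -/
def pairSS (n : ℕ) (F E : Finset (Fin n)) : Prop := ∀ k < E.card, nth n F k ≤ nth n E k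

/-- A filling by columns (leftmost column first) is semistandard iff all adjacent pairs are. -/
def isSSYT (n : ℕ) (L : List (Finset (Fin n))) : Prop := L.Chain' (pairSS n)

/-- The set `B(ϖ_ℓ)` of columns of length `ℓ`. -/
def colFinset (n : ℕ) (ℓ : ℕ) : Finset (Finset (Fin n)) := Finset.univ.filter fun C => C.card = ℓ

/-- The highest weight column `(1, …, k)`. -/
def hwCol (n : ℕ) (k : ℕ) : Finset (Fin n) := Finset.univ.filter fun x => (x : ℕ) < k

/-- The vector `⃗C ∈ ℤⁿ` attached to a column `C`. -/
def vecOf (n : ℕ) (C : Finset (Fin n)) : Fin n → ℤ := fun i => if i ∈ C then 1 else 0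

/-- The sign `σ^j_C`: `-1` if `j ∈ C` and `j+1 ∉ C`, and `+1` otherwise. -/
def sigmaSign (n : ℕ) (j : ℕ) (C : Finset (Fin n)) : ℤ :=
  if h : j + 1 < n then
    (if (⟨j, Nat.lt_of_succ_lt h⟩ : Fin n) ∈ C ∧ (⟨j + 1, h⟩ : Fin n) ∉ C then -1 else 1)
  else 1

/-! ### Shapes and tableaux -/

/-- The length `λ'_{j+1}` of the `(j+1)`-st column (0-indexed `j`) of the Young diagram
of a partition `λ`. -/
def shapeColLen (n : ℕ) (μ : Fin n → ℤ) (j : ℕ) : ℕ :=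
  (Finset.univ.filter fun i : Fin n => (j : ℤ) < μ i).card

/-- The number of columns of the Young diagram of a dominant weight. -/
def numCols (n : ℕ) (μ : Fin n → ℤ) : ℕ := Finset.univ.sup fun i : Fin n => (μ i).toNat

/-- The highest weight tableau `T⁰_μ`: row `i` is filled with `i`, i.e. its columns are the
highest weight columns. -/
def hwTableau (n : ℕ) (μ : Fin n → ℤ) : List (Finset (Fin n)) :=
  List.ofFn fun j : Fin (numCols n μ) => hwCol n (shapeColLen n μ (j : ℕ))

/-- The content vector of a tableau: `(wtVec T) i` is the number of entries equal to `i`. -/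
def wtVec (n : ℕ) (L : List (Finset (Fin n))) : Fin n → ℤ :=
  fun i => ((L.filter fun C => i ∈ C).length : ℤ)

/-! ### Macdonald's ψ statistic -/

/-- Number of entries `≤ i` in the column at position `p` (0-indexed from the left). -/
def colCount (n : ℕ) (L : List (Finset (Fin n))) (i p : ℕ) : ℕ :=
  ((L.getD p ∅).filter fun x => (x : ℕ) < i).card

/-- The factor `ψ_{T_{≤ i+1}/T_{≤ i}}` of Macdonald's ψ. -/
def stripFactor (n : ℕ) (L : List (Finset (Fin n))) (i : ℕ) : HR :=
  ∏ p ∈ Finset.range L.length,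
    if colCount n L (i + 1) p = colCount n L i p ∧
        colCount n L (i + 1) (p + 1) = colCount n L i (p + 1) + 1 then
      1 - tt ^ (colCount n L i p - colCount n L i (p + 1))
    else 1

/-- Macdonald's `ψ_T = ∏_{i=1}^{n-1} ψ_{T_{≤ i+1}/T_{≤ i}}` for a semistandard tableau. -/
def macPsi (n : ℕ) (L : List (Finset (Fin n))) : HR := ∏ i ∈ Finset.Ico 1 n, stripFactor n L i

/-- Macdonald's tableau statistic, extended by `0` to non-semistandard fillings. -/
def psiT (n : ℕ) (L : List (Finset (Fin n))) : HR := if isSSYT n L then macPsi n L else 0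

/-! ### The affine Hecke algebra -/

/-- Generators of the affine Hecke algebra. -/
inductive AGen (n : ℕ) : Type
  | T : ℕ → AGen n
  | X : Fin n → AGen n
  | Xinv : Fin n → AGen n

/-- The free algebra on the generators. -/
abbrev FA (n : ℕ) := FreeAlgebra HR (AGen n)

def fT (n : ℕ) (j : ℕ) : FA n := FreeAlgebra.ι HR (AGen.T j)
def fX (n : ℕ) (i : Fin n) : FA n := FreeAlgebra.ι HR (AGen.X i)
def fXi (n : ℕ) (i : Fin n) : FA n := FreeAlgebra.ι HR (AGen.Xinv i)

/-- The defining relations of the type `GL_n` affine Hecke algebra. -/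
inductive ARel (n : ℕ) : FA n → FA n → Prop
  | junk (j : ℕ) (h : ¬ j + 1 < n) : ARel n (fT n j) 1
  | quad (j : ℕ) (h : j + 1 < n) :
      ARel n (fT n j * fT n j) ((tt - 1) • fT n j + algebraMap HR (FA n) tt)
  | braid (j : ℕ) (h : j + 2 < n) :
      ARel n (fT n j * fT n (j + 1) * fT n j) (fT n (j + 1) * fT n j * fT n (j + 1))
  | commT (j k : ℕ) (hjk : j + 1 < k) (hk : k + 1 < n) :
      ARel n (fT n j * fT n k) (fT n k * fT n j)
  | commX (i i' : Fin n) : ARel n (fX n i * fX n i') (fX n i' * fX n i)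
  | XinvL (i : Fin n) : ARel n (fX n i * fXi n i) 1
  | XinvR (i : Fin n) : ARel n (fXi n i * fX n i) 1
  | TXT (j : ℕ) (h : j + 1 < n) :
      ARel n (fT n j * fX n ⟨j, Nat.lt_of_succ_lt h⟩ * fT n j) (tt • fX n ⟨j + 1, h⟩)
  | TXcomm (j : ℕ) (h : j + 1 < n) (i : Fin n) (hi1 : (i : ℕ) ≠ j) (hi2 : (i : ℕ) ≠ j + 1) :
      ARel n (fT n j * fX n i) (fX n i * fT n j)

/-- The type `GL_n` affine Hecke algebra. -/
abbrev H (n : ℕ) := RingQuot (ARel n)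

/-- The generator `T_j` of the (affine) Hecke algebra. -/
def Tg (n : ℕ) (j : ℕ) : H n := RingQuot.mkAlgHom HR (ARel n) (fT n j)

/-- The generator `X_i`. -/
def Xg (n : ℕ) (i : Fin n) : H n := RingQuot.mkAlgHom HR (ARel n) (fX n i)

/-- The generator `X_i⁻¹`. -/
def Xig (n : ℕ) (i : Fin n) : H n := RingQuot.mkAlgHom HR (ARel n) (fXi n i)

/-- The scalar `t` inside `H`. -/
def tH (n : ℕ) : H n := algebraMap HR (H n) tt

/-- The scalar `t^k` inside `H`. -/
def tpow (n : ℕ) (k : ℕ) : H n := algebraMap HR (H n) (tt ^ k)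

/-- The monomial `X^μ` for `μ ∈ ℤⁿ`. -/
def Xmon (n : ℕ) (μ : Fin n → ℤ) : H n :=
  (List.ofFn fun i : Fin n =>
    if 0 ≤ μ i then Xg n i ^ (μ i).toNat else Xig n i ^ (-μ i).toNat).prod

/-- The product `T_{i₁} ⋯ T_{i_ℓ}` of a word. -/
def TofWord (n : ℕ) (l : List ℕ) : H n := (l.map (Tg n)).prod

/-- The element `T_w`, defined via a choice of reduced word for `w`. -/
def Tw (n : ℕ) (w : Equiv.Perm (Fin n)) : H n := TofWord n (redWord n w)

/-- The finite Hecke symmetrizer `1₀ = Σ_{w ∈ S_n} T_w`. -/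
def one0 (n : ℕ) : H n := ∑ w : Equiv.Perm (Fin n), Tw n w

/-- The stabilizer `S_{n,λ}` as a finset. -/
def stabFinset (n : ℕ) (lam : Fin n → ℤ) : Finset (Equiv.Perm (Fin n)) :=
  Finset.univ.filter fun w => wAct n w lam = lam

/-- The parabolic symmetrizer `1_λ = Σ_{w ∈ S_{n,λ}} T_w`. -/
def onePara (n : ℕ) (lam : Fin n → ℤ) : H n := ∑ w ∈ stabFinset n lam, Tw n w

/-- The Poincaré polynomial `W_λ(t) = Σ_{w ∈ S_{n,λ}} t^{ℓ(w)}`. -/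
def Wlam (n : ℕ) (lam : Fin n → ℤ) : HR := ∑ w ∈ stabFinset n lam, tt ^ len n w

/-- The parabolic subalgebra `H_{n,λ}`, as the span of `{T_w : w ∈ S_{n,λ}}`. -/
def HparaM (n : ℕ) (lam : Fin n → ℤ) : Submodule HR (H n) :=
  Submodule.span HR (Tw n '' {w | wAct n w lam = lam})

/-- The finite Hecke algebra `H_n`, the subalgebra generated by the `T_j`. -/
def Hfin (n : ℕ) : Subalgebra HR (H n) := Algebra.adjoin HR (Set.range (Tg n))

/-- The coefficient `h_{C, S}` of the parabolic decomposition
`h = Σ_{F ∈ B(ϖ_ℓ)} T_{u_F} h_F` (defined via choice; it is unique). -/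
def paraCoeff (n : ℕ) (ℓ : ℕ) (h : H n) (C : Finset (Fin n)) : H n :=
  if hex : ∃ g : Finset (Fin n) → H n,
      (∀ F : Finset (Fin n), F.card = ℓ → g F ∈ HparaM n (varpi n ℓ)) ∧
      h = ∑ F ∈ colFinset n ℓ, Tw n (colPerm n F) * g F
  then hex.choose C else 0

/-- The elements `Ψ_T` of the finite Hecke algebra, defined by recursion on the columns of `T`
(leftmost column first).  By convention `Ψ` of the empty tableau is `1₀`. -/
def Psi (n : ℕ) : List (Finset (Fin n)) → H n
  | [] => one0 n
  | [C] => tpow n (len n (colPerm n C)) * Ring.inverse (Tw n (colPerm n C)⁻¹) *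
      onePara n (varpi n C.card)
  | C :: S => tpow n (len n (colPerm n C)) * Ring.inverse (Tw n (colPerm n C)⁻¹) *
      paraCoeff n C.card (Psi n S) C

end HLHecke

namespace HLHecke

/-! ### Relations -/
section rels
variable {n : ℕ}

lemma Tg_quad (j : ℕ) (h : j + 1 < n) :
    Tg n j * Tg n j = (tt - 1) • Tg n j + tt • (1 : H n) := by
  have := RingQuot.mkAlgHom_rel HR (ARel.quad (n := n) j h)
  simpa only [map_mul, map_add, map_smul, Algebra.algebraMap_eq_smul_one, map_one, Tg] using this

lemma Tg_braid (j : ℕ) (h : j + 2 < n) :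
    Tg n j * Tg n (j+1) * Tg n j = Tg n (j+1) * Tg n j * Tg n (j+1) := by
  have := RingQuot.mkAlgHom_rel HR (ARel.braid (n := n) j h)
  simpa only [map_mul, Tg, Xg] using this

lemma Tg_comm (j k : ℕ) (h : j + 1 < k) (hk : k + 1 < n) :
    Tg n j * Tg n k = Tg n k * Tg n j := by
  have := RingQuot.mkAlgHom_rel HR (ARel.commT (n := n) j k h hk)
  simpa only [map_mul, Tg, Xg] using this

lemma Xg_comm (i i' : Fin n) : Xg n i * Xg n i' = Xg n i' * Xg n i := by
  have := RingQuot.mkAlgHom_rel HR (ARel.commX (n := n) i i')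
  simpa only [map_mul, Tg, Xg] using this

lemma TXT (a b : Fin n) (h : (a : ℕ) + 1 = b) :
    Tg n a * Xg n a * Tg n a = tt • Xg n b := by
  have hb : (a : ℕ) + 1 < n := h ▸ b.2
  have := RingQuot.mkAlgHom_rel HR (ARel.TXT (n := n) a hb)
  have e : b = ⟨a+1, hb⟩ := Fin.ext h.symm
  rw [e]
  simpa only [map_mul, map_smul, Tg, Xg] using this

lemma TX_comm (a b i : Fin n) (h : (a : ℕ) + 1 = b) (h1 : i ≠ a) (h2 : i ≠ b) :
    Tg n a * Xg n i = Xg n i * Tg n a := by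
  have hb : (a : ℕ) + 1 < n := h ▸ b.2
  have := RingQuot.mkAlgHom_rel HR (ARel.TXcomm (n := n) a hb i
    (fun h => h1 (Fin.ext h)) (fun h' => h2 (Fin.ext (h'.trans h))))
  simpa only [map_mul, Tg, Xg] using this

lemma sgen_eq (a b : Fin n) (h : (a : ℕ) + 1 = b) : sgen n a = Equiv.swap a b := by
  have hb : (a : ℕ) + 1 < n := h ▸ b.2
  have e : b = ⟨a+1, hb⟩ := Fin.ext h.symm
  rw [sgen, dif_pos hb, e]

lemma tt_unit : IsUnit tt := LaurentPolynomial.isUnit_T 1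

lemma smul_tt_inj {x y : H n} (h : tt • x = tt • y) : x = y := by
  obtain ⟨u, hu⟩ := tt_unit
  rw [← hu] at h
  have := congrArg (fun z => (↑u⁻¹ : HR) • z) h
  simpa [smul_smul] using this

end rels

/-! ### Inversions -/
section inv
variable {n : ℕ}

lemma swap_lt_iff (a b p q : Fin n) (h : (a : ℕ) + 1 = b) (h1 : ¬ (p = a ∧ q = b))
    (h2 : ¬ (p = b ∧ q = a)) : Equiv.swap a b p < Equiv.swap a b q ↔ p < q := by
  simp only [Equiv.swap_apply_def]
  have : ∀ x y : Fin n, x = y ↔ (x:ℕ) = y := fun x y => Fin.ext_iff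
  simp only [this, Fin.lt_def] at *
  split_ifs <;> omega

def Inv (w : Equiv.Perm (Fin n)) : Finset (Fin n × Fin n) :=
  Finset.univ.filter fun p => p.1 < p.2 ∧ w⁻¹ p.2 < w⁻¹ p.1

def inv (w : Equiv.Perm (Fin n)) : ℕ := (Inv w).card

lemma inv_asc (w : Equiv.Perm (Fin n)) (a b : Fin n) (h : (a : ℕ) + 1 = b)
    (hw : w⁻¹ a < w⁻¹ b) : inv (sgen n a * w) = inv w + 1 := by
  rw [sgen_eq a b h]
  have hab : a ≠ b := fun e => by rw [e] at h; omega
  have hlt : a < b := by rw [Fin.lt_def]; omega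
  set s := Equiv.swap a b with hs
  have key : Inv (s * w) = insert (a, b) ((Inv w).map (Equiv.prodCongr s s).toEmbedding) := by
    ext ⟨p, q⟩
    rw [Finset.mem_insert, Finset.mem_map_equiv]
    simp only [Inv, Finset.mem_filter, Finset.mem_univ, true_and, mul_inv_rev, Equiv.Perm.mul_apply,
      Equiv.prodCongr_symm, Equiv.prodCongr_apply, Prod.map, Prod.mk.injEq]
    have e1 : ∀ x, s.symm x = s x := fun x => by rw [hs, Equiv.symm_swap]
    have e2 : ∀ x, s⁻¹ x = s x := fun x => by rw [hs, Equiv.swap_inv]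
    simp only [e1, e2]
    by_cases h1 : p = a ∧ q = b
    · obtain ⟨rfl, rfl⟩ := h1
      simp [hs, hlt]
      exact hw
    by_cases h2 : p = b ∧ q = a
    · obtain ⟨rfl, rfl⟩ := h2
      simp [hs, hab.symm]
      intro h0; exact absurd h0 hw.not_gt
    rw [swap_lt_iff a b p q h h1 h2]
    tauto
  have hnot : (a, b) ∉ (Inv w).map (Equiv.prodCongr s s).toEmbedding := by
    rw [Finset.mem_map_equiv]
    have e1 : ∀ x, s.symm x = s x := fun x => by rw [hs, Equiv.symm_swap]
    simp [Inv, e1, hs, hlt.le]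
  rw [inv, key, Finset.card_insert_of_notMem hnot, Finset.card_map]; rfl

lemma sgen_sq (a : ℕ) : sgen n a * sgen n a = 1 := by
  unfold sgen; split_ifs <;> simp

lemma sgen_mul_cancel (a : ℕ) (w : Equiv.Perm (Fin n)) : sgen n a * (sgen n a * w) = w := by
  rw [← mul_assoc, sgen_sq, one_mul]

lemma sgen_inv (a : ℕ) : (sgen n a)⁻¹ = sgen n a := by
  rw [inv_eq_iff_mul_eq_one, sgen_sq]

lemma smul_inv_a (w : Equiv.Perm (Fin n)) (a b : Fin n) (h : (a : ℕ) + 1 = b) :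
    (sgen n a * w)⁻¹ a = w⁻¹ b := by
  rw [mul_inv_rev, sgen_inv, sgen_eq a b h]; simp

lemma smul_inv_b (w : Equiv.Perm (Fin n)) (a b : Fin n) (h : (a : ℕ) + 1 = b) :
    (sgen n a * w)⁻¹ b = w⁻¹ a := by
  rw [mul_inv_rev, sgen_inv, sgen_eq a b h]; simp

lemma smul_inv_c (w : Equiv.Perm (Fin n)) (a b c : Fin n) (h : (a : ℕ) + 1 = b)
    (h1 : c ≠ a) (h2 : c ≠ b) :
    (sgen n a * w)⁻¹ c = w⁻¹ c := by
  rw [mul_inv_rev, sgen_inv, sgen_eq a b h]; simp [Equiv.swap_apply_of_ne_of_ne h1 h2]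

lemma inv_desc (w : Equiv.Perm (Fin n)) (a b : Fin n) (h : (a : ℕ) + 1 = b)
    (hw : w⁻¹ b < w⁻¹ a) : inv w = inv (sgen n a * w) + 1 := by
  have := inv_asc (sgen n a * w) a b h (by rwa [smul_inv_a w a b h, smul_inv_b w a b h])
  rwa [sgen_mul_cancel] at this

lemma asc_or_desc (w : Equiv.Perm (Fin n)) (a b : Fin n) (h : (a : ℕ) + 1 = b) :
    w⁻¹ a < w⁻¹ b ∨ w⁻¹ b < w⁻¹ a := by
  apply lt_or_gt_of_ne
  intro e
  have := w⁻¹.injective e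
  rw [this] at h; omega

lemma inv_le (w : Equiv.Perm (Fin n)) (a b : Fin n) (h : (a : ℕ) + 1 = b) :
    inv (sgen n a * w) ≤ inv w + 1 := by
  rcases asc_or_desc w a b h with hw | hw
  · rw [inv_asc w a b h hw]
  · have := inv_desc w a b h hw; omega

lemma inv_one : inv (1 : Equiv.Perm (Fin n)) = 0 := by
  rw [inv, Finset.card_eq_zero, Inv, Finset.filter_eq_empty_iff]
  rintro ⟨p, q⟩ -
  simp only [inv_one, Equiv.Perm.one_apply]
  intro h; exact absurd h.1 h.2.not_gt

lemma strictMono_of_adj {α : Type*} [Preorder α] (f : Fin n → α)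
    (hf : ∀ a b : Fin n, (a : ℕ) + 1 = b → f a < f b) : StrictMono f := by
  cases n with
  | zero => intro a; exact a.elim0
  | succ m =>
    rw [Fin.strictMono_iff_lt_succ]
    intro i; exact hf _ _ (by simp)

lemma exists_desc (w : Equiv.Perm (Fin n)) (hw : w ≠ 1) :
    ∃ a b : Fin n, (a : ℕ) + 1 = b ∧ w⁻¹ b < w⁻¹ a := by
  by_contra hc
  push Not at hc
  have hm : StrictMono (w⁻¹ : Equiv.Perm (Fin n)) := by
    apply strictMono_of_adj
    intro a b h
    rcases asc_or_desc w a b h with h' | h'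
    · exact h'
    · exact absurd h' (hc a b h).not_gt
  apply hw
  have : (StrictMono.orderIsoOfSurjective _ hm (w⁻¹).surjective) = OrderIso.refl _ :=
    Subsingleton.elim _ _
  have e : w⁻¹ = 1 := by
    ext x
    have := congrArg (fun f => f x) this
    simp at this
    have this : w⁻¹ x = x := this
    rw [this]; simp
  exact inv_eq_one.mp e

def valid (n : ℕ) (l : List ℕ) : Prop := ∀ j ∈ l, j + 1 < n

lemma wordProd_cons (j : ℕ) (l : List ℕ) : wordProd n (j :: l) = sgen n j * wordProd n l := by
  simp [wordProd]

lemma TofWord_cons (j : ℕ) (l : List ℕ) : TofWord n (j :: l) = Tg n j * TofWord n l := by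
  simp [TofWord]

lemma inv_le_length (l : List ℕ) (hl : valid n l) : inv (wordProd n l) ≤ l.length := by
  induction l with
  | nil => simp [wordProd, inv_one]
  | cons j l ih =>
    have hj := hl j (by simp)
    have := ih (fun x hx => hl x (by simp [hx]))
    have h2 := inv_le (wordProd n l) ⟨j, by omega⟩ ⟨j+1, hj⟩ rfl
    rw [wordProd_cons, List.length_cons]
    simp only at h2
    omega

lemma exists_red (w : Equiv.Perm (Fin n)) :
    ∃ l, valid n l ∧ l.length = inv w ∧ wordProd n l = w := by
  induction hk : inv w generalizing w with
  | zero =>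
    have : w = 1 := by
      by_contra hw
      obtain ⟨a, b, h, hd⟩ := exists_desc w hw
      have := inv_desc w a b h hd
      omega
    exact ⟨[], by simp [valid], rfl, by simp [wordProd, this]⟩
  | succ k ih =>
    have hw : w ≠ 1 := by rintro rfl; rw [inv_one] at hk; omega
    obtain ⟨a, b, h, hd⟩ := exists_desc w hw
    have := inv_desc w a b h hd
    obtain ⟨l, h1, h2, h3⟩ := ih (sgen n a * w) (by omega)
    refine ⟨a :: l, ?_, by simp [h2], by rw [wordProd_cons, h3, sgen_mul_cancel]⟩
    intro j hj
    rcases List.mem_cons.mp hj with rfl | hj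
    · rw [h]; exact b.2
    · exact h1 j hj

lemma len_eq (w : Equiv.Perm (Fin n)) : len n w = inv w := by
  apply le_antisymm
  · obtain ⟨l, h1, h2, h3⟩ := exists_red w
    exact Nat.sInf_le ⟨l, h1, h2, h3⟩
  · obtain ⟨l, h1, h2, h3⟩ := exists_red w
    have := Nat.sInf_mem (s := {k | ∃ l : List ℕ, (∀ j ∈ l, j + 1 < n) ∧ l.length = k ∧
      wordProd n l = w}) ⟨_, l, h1, h2, h3⟩
    obtain ⟨l', h1, h2, h3⟩ := this
    unfold len
    rw [← h2, ← h3]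
    exact inv_le_length l' h1

lemma redWord_spec (w : Equiv.Perm (Fin n)) :
    valid n (redWord n w) ∧ (redWord n w).length = inv w ∧ wordProd n (redWord n w) = w := by
  have h : ∃ l : List ℕ, (∀ j ∈ l, j + 1 < n) ∧ l.length = len n w ∧ wordProd n l = w := by
    rw [len_eq]; exact exists_red w
  rw [redWord, dif_pos h, ← len_eq]
  exact h.choose_spec

lemma red_cons (j : ℕ) (l : List ℕ) (hl : valid n (j :: l))
    (h : (j :: l).length = inv (wordProd n (j :: l))) :
    ∃ a b : Fin n, (a : ℕ) = j ∧ (a : ℕ) + 1 = b ∧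
      (wordProd n (j::l))⁻¹ b < (wordProd n (j::l))⁻¹ a ∧ valid n l ∧
      l.length = inv (wordProd n l) ∧ wordProd n l = sgen n a * wordProd n (j::l) := by
  have hj := hl j (by simp)
  have hl' : valid n l := fun x hx => hl x (by simp [hx])
  have h0 := inv_le_length l hl'
  have h2 := inv_le (wordProd n l) ⟨j, by omega⟩ ⟨j+1, hj⟩ rfl
  simp only at h2
  have e : wordProd n l = sgen n j * wordProd n (j::l) := by
    rw [wordProd_cons, sgen_mul_cancel]
  refine ⟨⟨j, by omega⟩, ⟨j+1, hj⟩, rfl, rfl, ?_, hl', ?_, e⟩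
  · rcases asc_or_desc (wordProd n (j::l)) ⟨j, by omega⟩ ⟨j+1, hj⟩ rfl with hh | hh
    · exfalso
      have := inv_asc _ _ _ rfl hh
      simp only [← e] at this
      rw [List.length_cons] at h; omega
    · exact hh
  · rw [wordProd_cons, List.length_cons] at h; omega

theorem matsumoto (l l' : List ℕ) (hl : valid n l) (hl' : valid n l')
    (h : l.length = inv (wordProd n l)) (h' : l'.length = inv (wordProd n l'))
    (e : wordProd n l = wordProd n l') : TofWord n l = TofWord n l' := by
  induction hk : l.length using Nat.strong_induction_on generalizing l l' with
  | _ k ih =>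
  cases l with
  | nil =>
    have : l' = [] := by
      rw [← List.length_eq_zero_iff, h', ← e]
      simp [wordProd, inv_one]
    rw [this]
  | cons j l =>
  cases l' with
  | nil =>
    exfalso
    rw [e] at h; simp [wordProd, inv_one] at h
  | cons j' l' =>
  obtain ⟨a, b, haj, hab, hd, hv, hr, hp⟩ := red_cons j l hl h
  obtain ⟨a', b', haj', hab', hd', hv', hr', hp'⟩ := red_cons j' l' hl' h'
  rw [← e] at hd' hp'
  set w := wordProd n (j :: l) with hw
  rw [TofWord_cons, TofWord_cons, ← haj, ← haj']
  -- wlog a ≤ a'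
  have main : ∀ (a b a' b' : Fin n) (l l' : List ℕ), (a : ℕ) + 1 = b → (a' : ℕ) + 1 = b' →
      w⁻¹ b < w⁻¹ a → w⁻¹ b' < w⁻¹ a' → valid n l → valid n l' →
      l.length = inv (wordProd n l) → l'.length = inv (wordProd n l') →
      wordProd n l = sgen n a * w → wordProd n l' = sgen n a' * w → a ≤ a' → inv w = k →
      Tg n a * TofWord n l = Tg n a' * TofWord n l' := by
    intro a b a' b' l l' hab hab' hd hd' hv hv' hr hr' hp hp' hle hwk
    have q1 := inv_desc w a b hab hd
    have q2 := inv_desc w a' b' hab' hd'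
    rw [← hp, ← hr] at q1
    rw [← hp', ← hr'] at q2
    have hbn : (a : ℕ) + 1 < n := by rw [hab]; exact b.2
    have hbn' : (a' : ℕ) + 1 < n := by rw [hab']; exact b'.2
    have cons_valid : ∀ (x : ℕ) (l : List ℕ), x + 1 < n → valid n l → valid n (x :: l) := by
      intro x l hx hl y hy
      rcases List.mem_cons.mp hy with rfl | hy
      · exact hx
      · exact hl y hy
    rcases eq_or_lt_of_le hle with rfl | hlt
    · rw [ih l.length (by omega) l l' hv hv' hr hr' (hp.trans hp'.symm) rfl]
    by_cases hfar : (a : ℕ) + 1 < a'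
    · -- commuting case
      set v := sgen n a' * (sgen n a * w) with hvdef
      have hcomm : sgen n a * sgen n a' = sgen n a' * sgen n a := by
        rw [sgen_eq a b hab, sgen_eq a' b' hab']
        apply Equiv.Perm.Disjoint.commute
        intro x
        by_cases hx : x = a ∨ x = b
        · right
          apply Equiv.swap_apply_of_ne_of_ne <;> rintro rfl <;> rcases hx with hx | hx <;>
            rw [Fin.ext_iff] at hx <;> omega
        · left; push Not at hx
          exact Equiv.swap_apply_of_ne_of_ne hx.1 hx.2
      have hv2 : v = sgen n a * (sgen n a' * w) := by
        rw [hvdef, ← mul_assoc, ← mul_assoc, hcomm]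
      have d1 : (sgen n a * w)⁻¹ b' < (sgen n a * w)⁻¹ a' := by
        rw [smul_inv_c w a b b' hab, smul_inv_c w a b a' hab]
        · exact hd'
        all_goals (intro hx; rw [Fin.ext_iff] at hx; omega)
      have i1 := inv_desc (sgen n a * w) a' b' hab' d1
      obtain ⟨m, hm1, hm2, hm3⟩ := exists_red v
      rw [← hvdef, ← hp] at i1
      have e1 : TofWord n l = TofWord n (a' :: m) := by
        apply ih l.length (by omega) l _ hv (cons_valid _ _ hbn' hm1) hr _ _ rfl
        · rw [wordProd_cons, hm3, hvdef, sgen_mul_cancel, ← hp, List.length_cons, hm2, i1]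
        · rw [wordProd_cons, hm3, hvdef, sgen_mul_cancel, ← hp]
      have e2 : TofWord n l' = TofWord n (a :: m) := by
        apply ih l'.length (by omega) l' _ hv' (cons_valid _ _ hbn hm1) hr' _ _ rfl
        · rw [wordProd_cons, hm3, hv2, sgen_mul_cancel, ← hp', List.length_cons, hm2]; omega
        · rw [wordProd_cons, hm3, hv2, sgen_mul_cancel, ← hp']
      rw [e1, e2, TofWord_cons, TofWord_cons, ← mul_assoc, ← mul_assoc, Tg_comm _ _ hfar hbn']
    · -- braid case
      have ha' : (a' : ℕ) = a + 1 := by rw [Fin.lt_def] at hlt; omega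
      have hba : b = a' := Fin.ext (by omega)
      subst hba
      have ne1 : b' ≠ a := by intro hx; rw [Fin.ext_iff] at hx; omega
      have ne2 : b' ≠ b := by intro hx; rw [Fin.ext_iff] at hx; omega
      have ne3 : a ≠ b := by intro hx; rw [Fin.ext_iff] at hx; omega
      -- w, s_a w, s_b s_a w, s_a s_b s_a w
      have d1 : (sgen n a * w)⁻¹ b' < (sgen n a * w)⁻¹ b := by
        rw [smul_inv_c w a b b' hab ne1 ne2, smul_inv_b w a b hab]
        exact hd'.trans hd
      have d2 : (sgen n b * (sgen n a * w))⁻¹ b < (sgen n b * (sgen n a * w))⁻¹ a := by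
        rw [smul_inv_a _ b b' hab', smul_inv_c _ b b' a hab' ne3 ne1.symm,
          smul_inv_c w a b b' hab ne1 ne2, smul_inv_a w a b hab]
        exact hd'
      have i1 := inv_desc _ b b' hab' d1
      have i2 := inv_desc _ a b hab d2
      set v := sgen n a * (sgen n b * (sgen n a * w)) with hvdef
      have hv2 : v = sgen n b * (sgen n a * (sgen n b * w)) := by
        rw [hvdef]
        simp only [← mul_assoc]
        congr 1
        rw [sgen_eq a b hab, sgen_eq b b' hab']
        ext x
        simp only [Equiv.Perm.mul_apply, Equiv.swap_apply_def]
        split_ifs <;> simp_all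
      obtain ⟨m, hm1, hm2, hm3⟩ := exists_red v
      rw [← hp] at i1 i2
      have e1 : TofWord n l = TofWord n (b :: a :: m) := by
        apply ih l.length (by omega) l _ hv
          (cons_valid _ _ hbn' (cons_valid _ _ hbn hm1)) hr _ _ rfl
        · rw [wordProd_cons, wordProd_cons, hm3, hvdef, sgen_mul_cancel, sgen_mul_cancel, ← hp,
            List.length_cons, List.length_cons, hm2]; omega
        · rw [wordProd_cons, wordProd_cons, hm3, hvdef, sgen_mul_cancel, sgen_mul_cancel, ← hp]
      have e2 : TofWord n l' = TofWord n (a :: b :: m) := by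
        apply ih l'.length (by omega) l' _ hv'
          (cons_valid _ _ hbn (cons_valid _ _ hbn' hm1)) hr' _ _ rfl
        · rw [wordProd_cons, wordProd_cons, hm3, hv2, sgen_mul_cancel, sgen_mul_cancel, ← hp',
            List.length_cons, List.length_cons, hm2]; omega
        · rw [wordProd_cons, wordProd_cons, hm3, hv2, sgen_mul_cancel, sgen_mul_cancel, ← hp']
      rw [e1, e2]
      simp only [TofWord_cons, ← mul_assoc]
      have := Tg_braid (n := n) a (by omega)
      rw [← ha'] at this
      rw [this]
  have hwk : inv w = k := by rw [← h, hk]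
  rcases le_total a a' with hle | hle
  · exact main a b a' b' l l' hab hab' hd hd' hv hv' hr hr' hp hp' hle hwk
  · exact (main a' b' a b l' l hab' hab hd' hd hv' hv hr' hr hp' hp hle hwk).symm

lemma Tw_asc (w : Equiv.Perm (Fin n)) (a b : Fin n) (h : (a : ℕ) + 1 = b)
    (hw : w⁻¹ a < w⁻¹ b) : Tw n (sgen n a * w) = Tg n a * Tw n w := by
  obtain ⟨h1, h2, h3⟩ := redWord_spec w
  obtain ⟨k1, k2, k3⟩ := redWord_spec (sgen n a * w)
  rw [Tw, Tw, ← TofWord_cons]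
  apply matsumoto _ _ k1
  · intro y hy
    rcases List.mem_cons.mp hy with rfl | hy
    · rw [h]; exact b.2
    · exact h1 y hy
  · rw [k3, k2]
  · rw [wordProd_cons, h3, inv_asc w a b h hw, List.length_cons, h2]
  · rw [k3, wordProd_cons, h3]

lemma Tw_one : Tw n 1 = 1 := by
  obtain ⟨h1, h2, h3⟩ := redWord_spec (1 : Equiv.Perm (Fin n))
  rw [inv_one, List.length_eq_zero_iff] at h2
  rw [Tw, h2]; simp [TofWord]

/-- induction on permutations by ascents -/
lemma perm_induction {P : Equiv.Perm (Fin n) → Prop} (h1 : P 1)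
    (hs : ∀ w (a b : Fin n), (a : ℕ) + 1 = b → w⁻¹ a < w⁻¹ b → P w → P (sgen n a * w)) :
    ∀ w, P w := by
  intro w
  induction hk : inv w using Nat.strong_induction_on generalizing w with
  | _ k ih =>
  by_cases hw : w = 1
  · rw [hw]; exact h1
  obtain ⟨a, b, h, hd⟩ := exists_desc w hw
  have := inv_desc w a b h hd
  have h2 := hs (sgen n a * w) a b h (by rwa [smul_inv_a w a b h, smul_inv_b w a b h])
    (ih _ (by omega) _ rfl)
  rwa [sgen_mul_cancel] at h2

lemma Tg_one0 (a b : Fin n) (h : (a : ℕ) + 1 = b) : Tg n a * one0 n = tt • one0 n := by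
  have hbn : (a : ℕ) + 1 < n := by rw [h]; exact b.2
  set A := Finset.univ.filter fun w : Equiv.Perm (Fin n) => w⁻¹ a < w⁻¹ b
  have hsplit : one0 n = ∑ w ∈ A, Tw n w + ∑ w ∈ A, Tg n a * Tw n w := by
    rw [one0, ← Finset.sum_filter_add_sum_filter_not Finset.univ (fun w : Equiv.Perm (Fin n) => w⁻¹ a < w⁻¹ b)]
    congr 1
    apply Finset.sum_bij' (fun w _ => sgen n a * w) (fun w _ => sgen n a * w)
    · intro w hw
      simp only [A, Finset.mem_filter, Finset.mem_univ, true_and] at hw ⊢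
      rw [smul_inv_a w a b h, smul_inv_b w a b h]
      exact (asc_or_desc w a b h).resolve_left hw
    · intro w hw
      simp only [A, Finset.mem_filter, Finset.mem_univ, true_and] at hw ⊢
      rw [smul_inv_a w a b h, smul_inv_b w a b h]
      exact hw.not_gt
    · intro w _; exact sgen_mul_cancel _ _
    · intro w _; exact sgen_mul_cancel _ _
    · intro w hw
      simp only [Finset.mem_filter, Finset.mem_univ, true_and] at hw
      rw [← Tw_asc _ a b h, sgen_mul_cancel]
      rw [smul_inv_a w a b h, smul_inv_b w a b h]
      exact (asc_or_desc w a b h).resolve_left hw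
  rw [hsplit, ← Finset.mul_sum, mul_add, ← mul_assoc, Tg_quad _ hbn]
  rw [add_mul, smul_mul_assoc, smul_mul_assoc, one_mul, smul_add]
  module

lemma Tw_one0 (w : Equiv.Perm (Fin n)) : Tw n w * one0 n = tt ^ (len n w) • one0 n := by
  rw [len_eq]
  induction w using perm_induction with
  | h1 => rw [Tw_one, inv_one]; simp
  | hs w a b h hw ih =>
    rw [Tw_asc w a b h hw, mul_assoc, ih, mul_smul_comm, Tg_one0 a b h, smul_smul, inv_asc w a b h hw,
      pow_succ]

end inv
end HLHecke

namespace HLHecke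

section xmon
variable {n : ℕ}

lemma Xmon_eq (μ : Fin n → ℤ) (h : ∀ i, 0 ≤ μ i) :
    Xmon n μ = ((List.finRange n).map fun i => Xg n i ^ (μ i).toNat).prod := by
  rw [Xmon, List.ofFn_eq_map]
  congr 1
  apply List.map_congr_left
  intro i _
  rw [if_pos (h i)]

lemma prod_map_mul_comm {ι M : Type*} [Monoid M] (f g : ι → M) (h : ∀ i j, Commute (f i) (g j))
    (l : List ι) : (l.map fun i => f i * g i).prod = (l.map f).prod * (l.map g).prod := by
  induction l with
  | nil => simp
  | cons x l ih =>
    have : Commute (g x) (l.map f).prod := by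
      apply Commute.list_prod_right
      intro y hy
      obtain ⟨i, -, rfl⟩ := List.mem_map.mp hy
      exact (h i x).symm
    simp only [List.map_cons, List.prod_cons, ih]
    rw [mul_assoc, ← mul_assoc (g x), this.eq]
    simp only [mul_assoc]

lemma Xmon_add (μ ν : Fin n → ℤ) (h : ∀ i, 0 ≤ μ i) (h' : ∀ i, 0 ≤ ν i) :
    Xmon n (μ + ν) = Xmon n μ * Xmon n ν := by
  rw [Xmon_eq _ h, Xmon_eq _ h', Xmon_eq (μ + ν) (fun i => add_nonneg (h i) (h' i)),
    ← prod_map_mul_comm]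
  · congr 1
    apply List.map_congr_left
    intro i _
    rw [← pow_add, Pi.add_apply, Int.toNat_add (h i) (h' i)]
  · intro i j
    exact (show Commute (Xg n i) (Xg n j) from Xg_comm i j).pow_pow _ _

lemma Xmon_zero : Xmon n 0 = 1 := by
  rw [Xmon_eq 0 (fun i => le_refl _)]
  apply List.prod_eq_one
  intro x hx
  obtain ⟨i, -, rfl⟩ := List.mem_map.mp hx
  simp

lemma prod_map_ite_one {ι M : Type*} [Monoid M] (a : ι) (x : M)
    (l : List ι) (hl : l.Nodup) :
    (l.map fun i => if i = a then x else 1).prod = if a ∈ l then x else 1 := by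
  induction l with
  | nil => simp
  | cons y l ih =>
    rw [List.nodup_cons] at hl
    rw [List.map_cons, List.prod_cons, ih hl.2]
    by_cases hy : y = a
    · subst hy
      simp [hl.1]
    · have : a ≠ y := fun h => hy h.symm
      simp [hy, this]

lemma eps_nonneg (a : Fin n) : ∀ i, 0 ≤ eps n a i := by
  intro i; unfold eps; split_ifs <;> simp

lemma Xmon_eps (a : Fin n) : Xmon n (eps n a) = Xg n a := by
  rw [Xmon_eq _ (eps_nonneg a)]
  have := prod_map_ite_one a (Xg n a) (List.finRange n) (List.nodup_finRange n)
  rw [if_pos (List.mem_finRange a)] at this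
  refine Eq.trans ?_ this
  congr 1
  apply List.map_congr_left
  intro i _
  unfold eps
  split_ifs with h
  · simp [h]
  · simp

lemma T_Xmon_zero (a b : Fin n) (h : (a : ℕ) + 1 = b) (μ : Fin n → ℤ) (hμ : ∀ i, 0 ≤ μ i)
    (ha : μ a = 0) (hb : μ b = 0) : Tg n a * Xmon n μ = Xmon n μ * Tg n a := by
  rw [Xmon_eq _ hμ]
  apply Commute.list_prod_right
  intro x hx
  obtain ⟨i, -, rfl⟩ := List.mem_map.mp hx
  by_cases h1 : i = a
  · subst h1; simp [ha]
  by_cases h2 : i = b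
  · subst h2; simp [hb]
  exact (show Commute (Tg n a) (Xg n i) from TX_comm a b i h h1 h2).pow_right _

lemma T_XX (a b : Fin n) (h : (a : ℕ) + 1 = b) :
    Tg n a * (Xg n a * Xg n b) = (Xg n a * Xg n b) * Tg n a := by
  apply smul_tt_inj
  calc tt • (Tg n a * (Xg n a * Xg n b)) = Tg n a * Xg n a * (tt • Xg n b) := by
        rw [mul_smul_comm, mul_assoc]
    _ = (Tg n a * Xg n a * Tg n a) * Xg n a * Tg n a := by
        rw [← TXT a b h]; simp only [mul_assoc]
    _ = _ := by rw [TXT a b h, smul_mul_assoc, smul_mul_assoc, Xg_comm b a]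

lemma T_Xmon_eq (a b : Fin n) (h : (a : ℕ) + 1 = b) (μ : Fin n → ℤ) (hμ : ∀ i, 0 ≤ μ i)
    (hab : μ a = μ b) : Tg n a * Xmon n μ = Xmon n μ * Tg n a := by
  have hne : a ≠ b := fun e => by rw [e] at h; omega
  induction hk : (μ a).toNat generalizing μ with
  | zero =>
    have := hμ a
    exact T_Xmon_zero a b h μ hμ (by omega) (by omega)
  | succ k ih =>
    set ν := μ - eps n a - eps n b with hν
    have e : μ = ν + (eps n a + eps n b) := by rw [hν]; abel
    have va : ν a = μ a - 1 := by simp [hν, eps, hne]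
    have vb : ν b = μ b - 1 := by simp [hν, eps, hne.symm]
    have hν0 : ∀ i, 0 ≤ ν i := by
      intro i
      by_cases h1 : i = a
      · subst h1; omega
      by_cases h2 : i = b
      · subst h2; omega
      simp only [hν, Pi.sub_apply, eps, h1, h2, if_false, sub_zero]; exact hμ i
    have := ih ν hν0 (by omega) (by omega)
    rw [e, Xmon_add ν (eps n a + eps n b) hν0 (fun i => add_nonneg (eps_nonneg a i) (eps_nonneg b i)),
      Xmon_add _ _ (eps_nonneg a) (eps_nonneg b), Xmon_eps, Xmon_eps, ← mul_assoc, this,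
      mul_assoc, T_XX a b h]
    simp only [mul_assoc]

lemma T_Xmon_T (a b : Fin n) (h : (a : ℕ) + 1 = b) (μ : Fin n → ℤ) (hμ : ∀ i, 0 ≤ μ i)
    (ha : μ a = 1) (hb : μ b = 0) :
    Tg n a * Xmon n μ * Tg n a = tt • Xmon n (μ ∘ Equiv.swap a b) := by
  have hne : a ≠ b := fun e => by rw [e] at h; omega
  set ν := μ - eps n a with hν
  have va : ν a = 0 := by simp [hν, eps, ha]
  have vb : ν b = 0 := by simp [hν, eps, hne.symm, hb]
  have hν0 : ∀ i, 0 ≤ ν i := by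
    intro i
    by_cases h1 : i = a
    · subst h1; omega
    simp only [hν, Pi.sub_apply, eps, h1, if_false, sub_zero]; exact hμ i
  have e1 : μ = eps n a + ν := by rw [hν]; abel
  have e2 : μ ∘ Equiv.swap a b = eps n b + ν := by
    funext i
    simp only [Function.comp, Pi.add_apply]
    by_cases h1 : i = a
    · subst h1; simp [va, eps, hne, hb]
    by_cases h2 : i = b
    · subst h2; simp [vb, eps, ha]
    rw [Equiv.swap_apply_of_ne_of_ne h1 h2]
    simp [hν, eps, h1, h2]
  rw [e2, e1, Xmon_add _ _ (eps_nonneg a) hν0, Xmon_add _ _ (eps_nonneg b) hν0, Xmon_eps, Xmon_eps,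
    mul_assoc, mul_assoc, ← T_Xmon_zero a b h ν hν0 va vb, ← mul_assoc, ← mul_assoc, TXT a b h,
    smul_mul_assoc]

lemma vecOf_nonneg (F : Finset (Fin n)) : ∀ i, 0 ≤ vecOf n F i := by
  intro i; unfold vecOf; split_ifs <;> simp

end xmon

section cols
variable {n : ℕ}

/-- swapping `a, b` in a column -/
def sw (a b : Fin n) (F : Finset (Fin n)) : Finset (Fin n) :=
  F.map (Equiv.swap a b).toEmbedding

lemma mem_sw (a b x : Fin n) (F : Finset (Fin n)) : x ∈ sw a b F ↔ Equiv.swap a b x ∈ F := by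
  rw [sw, Finset.mem_map_equiv, Equiv.symm_swap]

lemma a_mem_sw (a b : Fin n) (F : Finset (Fin n)) : a ∈ sw a b F ↔ b ∈ F := by
  simp [mem_sw]

lemma b_mem_sw (a b : Fin n) (F : Finset (Fin n)) : b ∈ sw a b F ↔ a ∈ F := by
  simp [mem_sw]

lemma c_mem_sw (a b c : Fin n) (F : Finset (Fin n)) (h1 : c ≠ a) (h2 : c ≠ b) :
    c ∈ sw a b F ↔ c ∈ F := by
  rw [mem_sw, Equiv.swap_apply_of_ne_of_ne h1 h2]

lemma card_sw (a b : Fin n) (F : Finset (Fin n)) : (sw a b F).card = F.card := by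
  rw [sw, Finset.card_map]

lemma sw_sw (a b : Fin n) (F : Finset (Fin n)) : sw a b (sw a b F) = F := by
  ext x; simp [mem_sw]

lemma sw_fix (a b : Fin n) (F : Finset (Fin n)) (h : a ∈ F ↔ b ∈ F) : sw a b F = F := by
  ext x
  by_cases h1 : x = a
  · subst h1; rw [a_mem_sw, h]
  by_cases h2 : x = b
  · subst h2; rw [b_mem_sw, h]
  exact c_mem_sw a b x F h1 h2

lemma vecOf_sw (a b : Fin n) (F : Finset (Fin n)) :
    vecOf n (sw a b F) = vecOf n F ∘ Equiv.swap a b := by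
  funext i; simp [vecOf, mem_sw]

/-- number of entries `< i` -/
def cnt (F : Finset (Fin n)) (i : ℕ) : ℕ := (F.filter fun x : Fin n => (x : ℕ) < i).card

def fac (F E : Finset (Fin n)) (x : Fin n) : HR :=
  if x ∉ F ∧ x ∈ E then 1 - tt ^ (cnt F x - cnt E x) else 1

def aC (F E : Finset (Fin n)) : HR := ∏ x : Fin n, fac F E x

lemma cnt_succ (F : Finset (Fin n)) (x : Fin n) :
    cnt F ((x : ℕ) + 1) = cnt F x + if x ∈ F then 1 else 0 := by
  unfold cnt
  split_ifs with h
  · have : (F.filter fun y : Fin n => (y : ℕ) < x + 1) = insert x (F.filter fun y : Fin n => (y : ℕ) < x) := by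
      ext y
      simp only [Finset.mem_filter, Finset.mem_insert, Fin.ext_iff]
      constructor
      · rintro ⟨h1, h2⟩
        by_cases h3 : (y : ℕ) = x
        · exact Or.inl h3
        · exact Or.inr ⟨h1, by omega⟩
      · rintro (h1 | ⟨h1, h2⟩)
        · rw [Fin.ext h1]; exact ⟨h, by omega⟩
        · exact ⟨h1, by omega⟩
    rw [this, Finset.card_insert_of_notMem (by simp)]
  · rw [add_zero]
    congr 1
    ext y
    simp only [Finset.mem_filter]
    constructor
    · rintro ⟨h1, h2⟩
      refine ⟨h1, ?_⟩
      by_contra h3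
      exact h ((Fin.ext (show (y : ℕ) = x by omega)) ▸ h1)
    · rintro ⟨h1, h2⟩
      exact ⟨h1, by omega⟩

lemma cnt_succ_ge (F : Finset (Fin n)) (i : ℕ) (h : n ≤ i) : cnt F (i + 1) = cnt F i := by
  unfold cnt
  congr 1
  ext y
  simp only [Finset.mem_filter]
  have := y.2
  constructor <;> rintro ⟨h1, h2⟩ <;> exact ⟨h1, by omega⟩

lemma cnt_zero (F : Finset (Fin n)) : cnt F 0 = 0 := by simp [cnt]

lemma cnt_sw (a b : Fin n) (h : (a : ℕ) + 1 = b) (F : Finset (Fin n)) (i : ℕ) (hi : i ≠ b) :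
    cnt (sw a b F) i = cnt F i := by
  unfold cnt
  rw [sw, Finset.filter_map, Finset.card_map]
  congr 1
  ext y
  simp only [Finset.mem_filter, Function.comp, Equiv.coe_toEmbedding, Equiv.swap_apply_def]
  have : ∀ x y : Fin n, x = y ↔ (x:ℕ) = y := fun x y => Fin.ext_iff
  simp only [this]
  apply and_congr_right
  intro _
  split_ifs <;> omega

lemma exists_fac_zero (F E : Finset (Fin n)) (i : ℕ) (h : cnt F i < cnt E i) :
    ∃ x : Fin n, (x : ℕ) < i ∧ fac F E x = 0 := by
  induction i with
  | zero => simp [cnt_zero] at h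
  | succ i ih =>
    by_cases h1 : cnt F i < cnt E i
    · obtain ⟨x, hx, hx'⟩ := ih h1
      exact ⟨x, by omega, hx'⟩
    by_cases hi : i < n
    · have e1 := cnt_succ F ⟨i, hi⟩
      have e2 := cnt_succ E ⟨i, hi⟩
      simp only at e1 e2
      refine ⟨⟨i, hi⟩, by simp, ?_⟩
      unfold fac
      split_ifs at e1 e2 <;> try omega
      rw [if_pos ⟨by assumption, by assumption⟩]
      have : cnt F i - cnt E i = 0 := by omega
      simp [this]
    · rw [cnt_succ_ge F i (by omega), cnt_succ_ge E i (by omega)] at h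
      omega

def rest (a b : Fin n) (F E : Finset (Fin n)) : HR :=
  ∏ x ∈ (Finset.univ.erase b).erase a, fac F E x

lemma aC_split (a b : Fin n) (h : a ≠ b) (F E : Finset (Fin n)) :
    aC F E = rest a b F E * (fac F E a * fac F E b) := by
  unfold aC rest
  rw [← Finset.mul_prod_erase Finset.univ _ (Finset.mem_univ b),
    ← Finset.mul_prod_erase (Finset.univ.erase b) _ (a := a) (by simp [h])]
  ring

lemma rest_sw_left (a b : Fin n) (h : (a : ℕ) + 1 = b) (F E : Finset (Fin n)) :
    rest a b (sw a b F) E = rest a b F E := by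
  apply Finset.prod_congr rfl
  intro x hx
  simp only [Finset.mem_erase, Finset.mem_univ, and_true] at hx
  unfold fac
  simp only [cnt_sw a b h F x (fun h' => hx.2 (Fin.ext h')), c_mem_sw a b x F hx.1 hx.2]

lemma rest_sw_right (a b : Fin n) (h : (a : ℕ) + 1 = b) (F E : Finset (Fin n)) :
    rest a b F (sw a b E) = rest a b F E := by
  apply Finset.prod_congr rfl
  intro x hx
  simp only [Finset.mem_erase, Finset.mem_univ, and_true] at hx
  unfold fac
  simp only [cnt_sw a b h E x (fun h' => hx.2 (Fin.ext h')), c_mem_sw a b x E hx.1 hx.2]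

lemma rest_zero (a b : Fin n) (h : (a : ℕ) + 1 = b) (F E : Finset (Fin n))
    (hc : cnt F a < cnt E a) : rest a b F E = 0 := by
  obtain ⟨x, hx, hx'⟩ := exists_fac_zero F E a hc
  apply Finset.prod_eq_zero _ hx'
  simp only [Finset.mem_erase, Finset.mem_univ, and_true, ne_eq, Fin.ext_iff]
  omega

section coeffs
variable (a b : Fin n) (h : (a : ℕ) + 1 = b) (F E : Finset (Fin n))
include h

lemma hne : a ≠ b := fun e => by rw [e] at h; omega

lemma cnt_b : cnt F b = cnt F a + if a ∈ F then 1 else 0 := by rw [← h, cnt_succ]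

lemma cnt_sw_b : cnt (sw a b F) b = cnt F a + if b ∈ F then 1 else 0 := by
  rw [cnt_b a b h, cnt_sw a b h F a (by omega)]; simp only [a_mem_sw]

lemma cnt_sw_a : cnt (sw a b F) a = cnt F a := cnt_sw a b h F a (by omega)

lemma coef1 (hE : a ∈ E ↔ b ∈ E) (ha : a ∈ F) (hb : b ∉ F) : aC F E = aC (sw a b F) E := by
  rw [aC_split a b (hne a b h), aC_split a b (hne a b h), rest_sw_left a b h]
  congr 1
  simp only [fac, a_mem_sw, b_mem_sw, cnt_b a b h F, cnt_b a b h E, cnt_sw_b a b h F,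
    cnt_sw_a a b h F, ← hE, ha, hb]
  by_cases hh : a ∈ E <;> simp [hh]

lemma coef2 (hE : a ∈ E) (hE' : b ∉ E) (ha : a ∈ F) (hb : b ∉ F) :
    aC (sw a b F) (sw a b E) = aC F E := by
  rw [aC_split a b (hne a b h), aC_split a b (hne a b h), rest_sw_left a b h, rest_sw_right a b h]
  congr 1
  simp [fac, a_mem_sw, b_mem_sw, ha, hb, hE, hE']

lemma coef3 (hE : a ∈ E) (hE' : b ∉ E) (ha : a ∈ F) (hb : b ∉ F) :
    aC F (sw a b E) + aC F E * (tt - 1) = tt * aC (sw a b F) E := by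
  rw [aC_split a b (hne a b h), aC_split a b (hne a b h), aC_split a b (hne a b h),
    rest_sw_left a b h, rest_sw_right a b h]
  by_cases hc : cnt F a < cnt E a
  · rw [rest_zero a b h F E hc]; ring
  simp only [fac, a_mem_sw, b_mem_sw, cnt_b a b h F, cnt_b a b h E, cnt_sw_b a b h F,
    cnt_sw_a a b h F, cnt_sw_b a b h E, cnt_sw_a a b h E, ha, hb, hE, hE']
  have : cnt F a + 1 - cnt E a = (cnt F a - cnt E a) + 1 := by omega
  simp [this]
  ring

lemma coef4 (hE : a ∈ E) (hE' : b ∉ E) (hF : a ∈ F ↔ b ∈ F) :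
    aC F (sw a b E) = aC F E := by
  rw [aC_split a b (hne a b h), aC_split a b (hne a b h), rest_sw_right a b h]
  congr 1
  simp only [fac, a_mem_sw, b_mem_sw, cnt_b a b h F, cnt_b a b h E, cnt_sw_b a b h F,
    cnt_sw_a a b h F, cnt_sw_b a b h E, cnt_sw_a a b h E, ← hF, hE, hE']
  by_cases hh : a ∈ F <;> simp [hh]

end coeffs

/-- rule V on columns of size `f` -/
def RuleV (f : ℕ) (v : Finset (Fin n) → H n) : Prop :=
  ∀ (a b : Fin n) (F : Finset (Fin n)), (a : ℕ) + 1 = b → F.card = f →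
    (a ∈ F → b ∉ F → Tg n a * v (sw a b F) = tt • v F) ∧
    ((a ∈ F ↔ b ∈ F) → Tg n a * v F = tt • v F)

def RuleY (f : ℕ) (y : Finset (Fin n) → H n) : Prop :=
  ∀ (a b : Fin n) (F : Finset (Fin n)), (a : ℕ) + 1 = b → F.card = f →
    (a ∈ F → b ∉ F → Tg n a * y F = y (sw a b F)) ∧
    ((a ∈ F ↔ b ∈ F) → Tg n a * y F = tt • y F)

lemma ruleY_of_ruleV (f : ℕ) (v : Finset (Fin n) → H n) (hv : RuleV f v) :
    RuleY f (fun F => Xmon n (vecOf n F) * v F) := by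
  intro a b F h hF
  obtain ⟨h1, h2⟩ := hv a b F h hF
  constructor
  · intro ha hb
    apply smul_tt_inj
    show tt • (Tg n a * (Xmon n (vecOf n F) * v F)) = tt • (Xmon n (vecOf n (sw a b F)) * v (sw a b F))
    rw [← mul_smul_comm, ← mul_smul_comm, ← h1 ha hb, ← mul_assoc, ← mul_assoc,
      T_Xmon_T a b h _ (vecOf_nonneg F) (by simp [vecOf, ha]) (by simp [vecOf, hb]), vecOf_sw,
      smul_mul_assoc]
  · intro hab
    rw [← mul_assoc, T_Xmon_eq a b h _ (vecOf_nonneg F) (by simp [vecOf, hab]), mul_assoc,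
      h2 hab, mul_smul_comm]

lemma RuleY.sw {f : ℕ} {y : Finset (Fin n) → H n} (hy : RuleY f y) (a b : Fin n)
    (F : Finset (Fin n)) (h : (a : ℕ) + 1 = b) (hF : F.card = f) (ha : a ∈ F) (hb : b ∉ F) :
    Tg n a * y (sw a b F) = (tt - 1) • y (HLHecke.sw a b F) + tt • y F := by
  have e := (hy a b F h hF).1 ha hb
  rw [← e, ← mul_assoc, Tg_quad _ (by rw [h]; exact b.2), add_mul, smul_mul_assoc, smul_mul_assoc,
    one_mul]

lemma ruleV_of_ruleY (f e : ℕ) (y : Finset (Fin n) → H n) (hy : RuleY f y) :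
    RuleV e (fun E => ∑ F ∈ colFinset n f, aC F E • y F) := by
  intro a b E h hE
  have hmem : ∀ F, F ∈ colFinset n f ↔ F.card = f := by intro F; simp [colFinset]
  -- general pairing argument
  have gen : ∀ E1 E2 : Finset (Fin n),
      (∀ F, (a ∈ F ↔ b ∈ F) → aC F E1 = aC F E2) →
      (∀ F, a ∈ F → b ∉ F → aC (sw a b F) E1 = aC F E2 ∧
        aC F E1 + aC (sw a b F) E1 * (tt - 1) = tt * aC (sw a b F) E2) →
      Tg n a * ∑ F ∈ colFinset n f, aC F E1 • y F = tt • ∑ F ∈ colFinset n f, aC F E2 • y F := by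
    intro E1 E2 H1 H2
    rw [Finset.mul_sum, Finset.smul_sum]
    refine sub_eq_zero.mp ?_
    refine (Finset.sum_sub_distrib (s := colFinset n f) (fun F => Tg n a * aC F E1 • y F)
      (fun F => tt • aC F E2 • y F)).symm.trans ?_
    have up : ∀ F, F.card = f → a ∈ F → b ∉ F →
        (Tg n a * aC F E1 • y F - tt • aC F E2 • y F) +
        (Tg n a * aC (sw a b F) E1 • y (sw a b F) - tt • aC (sw a b F) E2 • y (sw a b F)) = 0 := by
      intro F hF ha hb
      obtain ⟨k1, k2⟩ := H2 F ha hb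
      rw [mul_smul_comm, mul_smul_comm, hy.sw a b F h hF ha hb, (hy a b F h hF).1 ha hb]
      rw [smul_smul tt (aC (sw a b F) E2), ← k2, k1]
      module
    have fixed : ∀ F, F.card = f → (a ∈ F ↔ b ∈ F) →
        Tg n a * aC F E1 • y F - tt • aC F E2 • y F = 0 := by
      intro F hF hab
      rw [mul_smul_comm, (hy a b F h hF).2 hab, H1 F hab, smul_comm]
      exact sub_self (tt • aC F E2 • y F)
    apply Finset.sum_involution (fun F _ => sw a b F)
    · intro F hF
      rw [hmem] at hF
      by_cases ha : a ∈ F <;> by_cases hb : b ∈ F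
      · rw [sw_fix a b F (by tauto), fixed F hF (by tauto), add_zero]
      · exact up F hF ha hb
      · have := up (sw a b F) (by rw [card_sw, hF]) (by rwa [a_mem_sw]) (by rwa [b_mem_sw])
        rw [sw_sw] at this
        rw [add_comm]; exact this
      · rw [sw_fix a b F (by tauto), fixed F hF (by tauto), add_zero]
    · intro F hF hnz heq
      rw [hmem] at hF
      apply hnz
      apply fixed F hF
      have := a_mem_sw a b F
      rwa [heq] at this
    · intro F hF; rw [hmem] at *; rw [card_sw, hF]
    · intro F hF; exact sw_sw a b F
  constructor
  · intro ha hb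
    apply gen
    · intro F hF; exact coef4 a b h F E ha hb hF
    · intro F hFa hFb
      have c2 := coef2 a b h F E ha hb hFa hFb
      have c3 := coef3 a b h F E ha hb hFa hFb
      exact ⟨c2, by rw [c2, c3]⟩
  · intro hab
    apply gen
    · intro F _; rfl
    · intro F hFa hFb
      have c1 := coef1 a b h F E hab hFa hFb
      exact ⟨c1.symm, by rw [c1]; ring⟩

end cols
end HLHecke

namespace HLHecke

section kap
variable {n : ℕ}

lemma exists_asc_adj (κ : Fin n → ℤ) (h : ¬ Antitone κ) :
    ∃ a b : Fin n, (a : ℕ) + 1 = b ∧ κ a < κ b := by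
  by_contra hc
  push Not at hc
  apply h
  cases n with
  | zero => intro a; exact a.elim0
  | succ m =>
    rw [Fin.antitone_iff_succ_le]
    intro i
    exact hc i.castSucc i.succ (by simp)

lemma comp_swap_swap (κ : Fin n → ℤ) (a b : Fin n) :
    (κ ∘ Equiv.swap a b) ∘ Equiv.swap a b = κ := by
  funext i; simp

lemma kind {P : (Fin n → ℤ) → Prop}
    (h0 : ∀ κ, (∀ i, 0 ≤ κ i) → Antitone κ → P κ)
    (hs : ∀ κ (a b : Fin n), (a : ℕ) + 1 = b → (∀ i, 0 ≤ κ i) → κ b < κ a → P κ →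
      P (κ ∘ Equiv.swap a b)) :
    ∀ κ, (∀ i, 0 ≤ κ i) → P κ := by
  intro κ hκ
  have hnn : ∀ κ : Fin n → ℤ, (∀ i, 0 ≤ κ i) → 0 ≤ ∑ i : Fin n, ((i : ℕ) : ℤ) * κ i := by
    intro κ hκ
    apply Finset.sum_nonneg
    intro i _
    exact mul_nonneg (by positivity) (hκ i)
  induction hm : (∑ i : Fin n, ((i : ℕ) : ℤ) * κ i).toNat using Nat.strong_induction_on
    generalizing κ with
  | _ m ih =>
    by_cases hA : Antitone κ
    · exact h0 κ hκ hA
    obtain ⟨a, b, hab, hlt⟩ := exists_asc_adj κ hA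
    have hne : a ≠ b := fun e => by rw [e] at hab; omega
    have hnu : ∀ i, 0 ≤ (κ ∘ Equiv.swap a b) i := fun i => hκ _
    have key : ∑ i : Fin n, ((i : ℕ) : ℤ) * (κ ∘ Equiv.swap a b) i <
        ∑ i : Fin n, ((i : ℕ) : ℤ) * κ i := by
      rw [← Equiv.sum_comp (Equiv.swap a b)]
      rw [← sub_pos, ← Finset.sum_sub_distrib, Fintype.sum_eq_add a b hne]
      · simp only [Function.comp, Equiv.swap_apply_left, Equiv.swap_apply_right, ← hab]
        push_cast
        nlinarith
      · intro c hc
        simp [Equiv.swap_apply_of_ne_of_ne hc.1 hc.2]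
    have := ih _ (by have := hnn _ hnu; omega) (κ ∘ Equiv.swap a b) hnu rfl
    have := hs _ a b hab hnu (by simpa using hlt) this
    rwa [comp_swap_swap] at this

def srt (κ : Fin n → ℤ) : Equiv.Perm (Fin n) := Tuple.sort (OrderDual.toDual ∘ κ)

def Yk (κ : Fin n → ℤ) : H n := Tw n (srt κ) * (Xmon n (κ ∘ srt κ) * one0 n)

lemma srt_swap (κ : Fin n → ℤ) (a b : Fin n) (h : (a : ℕ) + 1 = b) (hκ : κ b < κ a) :
    srt (κ ∘ Equiv.swap a b) = sgen n a * srt κ := by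
  symm
  unfold srt
  obtain ⟨h1, h2⟩ := (Tuple.eq_sort_iff (f := OrderDual.toDual ∘ κ)).mp rfl
  rw [Tuple.eq_sort_iff, sgen_eq a b h]
  constructor
  · intro i j hij
    have := h1 hij
    simpa using this
  · intro i j hij he
    simp only [Function.comp, Equiv.Perm.mul_apply, Equiv.swap_apply_self] at he ⊢
    have hlt := h2 i j hij he
    rw [swap_lt_iff a b _ _ h]
    · exact hlt
    · rintro ⟨e1, e2⟩
      rw [e1, e2] at he
      exact hκ.ne' (OrderDual.toDual.injective he)
    · rintro ⟨e1, e2⟩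
      rw [e1, e2] at he
      exact hκ.ne (OrderDual.toDual.injective he)

lemma srt_asc (κ : Fin n → ℤ) (a b : Fin n) (hκ : κ b < κ a) :
    (srt κ)⁻¹ a < (srt κ)⁻¹ b := by
  by_contra hc
  push Not at hc
  have := Tuple.monotone_sort (OrderDual.toDual ∘ κ) hc
  change κ (srt κ ((srt κ)⁻¹ a)) ≤ κ (srt κ ((srt κ)⁻¹ b)) at this
  simp at this
  omega

lemma Yk_up (κ : Fin n → ℤ) (a b : Fin n) (h : (a : ℕ) + 1 = b) (hκ : κ b < κ a) :
    Tg n a * Yk κ = Yk (κ ∘ Equiv.swap a b) := by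
  unfold Yk
  have e : (κ ∘ Equiv.swap a b) ∘ (sgen n a * srt κ : Equiv.Perm (Fin n)) = κ ∘ srt κ := by
    rw [sgen_eq a b h]; funext i; simp
  rw [srt_swap κ a b h hκ, Tw_asc _ a b h (srt_asc κ a b hκ), e, mul_assoc]

lemma Yk_anti (κ : Fin n → ℤ) (h : Antitone κ) : Yk κ = Xmon n κ * one0 n := by
  have : srt κ = 1 := by
    unfold srt
    rw [show (1 : Equiv.Perm (Fin n)) = Equiv.refl _ from rfl, Tuple.sort_eq_refl_iff_monotone]
    intro i j hij
    exact h hij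
  unfold Yk
  rw [this, Tw_one, one_mul]
  rfl

lemma varpi_nonneg (f : ℕ) : ∀ i, 0 ≤ varpi n f i := by
  intro i; unfold varpi; split_ifs <;> simp

lemma Yk_shift (f : ℕ) (κ : Fin n → ℤ) (hκ : ∀ i, 0 ≤ κ i)
    (hmax : ∀ i : Fin n, (i : ℕ) < f → ∀ j, κ j ≤ κ i) :
    Xmon n (varpi n f) * Yk κ = Yk (κ + varpi n f) := by
  revert hmax
  refine kind (P := fun κ => (∀ i : Fin n, (i : ℕ) < f → ∀ j, κ j ≤ κ i) →
    Xmon n (varpi n f) * Yk κ = Yk (κ + varpi n f)) ?_ ?_ κ hκ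
  · intro κ hκ hA hmax
    have hA' : Antitone (κ + varpi n f) := by
      intro i j hij
      have := hA hij
      have hij' : (i : ℕ) ≤ j := hij
      simp only [Pi.add_apply, varpi]
      split_ifs <;> omega
    rw [Yk_anti κ hA, Yk_anti _ hA', ← mul_assoc, ← Xmon_add _ _ (varpi_nonneg f) hκ, add_comm]
  · intro κ a b hab hκ hlt ih hmax
    have ha : ¬ (a : ℕ) < f := by
      intro ha
      have := hmax a ha b
      simp at this
      omega
    have hmax' : ∀ i : Fin n, (i : ℕ) < f → ∀ j, κ j ≤ κ i := by
      intro i hi j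
      have := hmax i hi (Equiv.swap a b j)
      have h1 : i ≠ a := by rintro rfl; omega
      have h2 : i ≠ b := by rintro rfl; omega
      simpa [Equiv.swap_apply_of_ne_of_ne h1 h2] using this
    have va : varpi n f a = 0 := by simp [varpi]; omega
    have vb : varpi n f b = 0 := by simp [varpi]; omega
    rw [← Yk_up κ a b hab hlt, ← mul_assoc,
      ← T_Xmon_eq a b hab _ (varpi_nonneg f) (by rw [va, vb]), mul_assoc, ih hmax',
      Yk_up _ a b hab (by simp [va, vb]; exact hlt)]
    congr 1
    funext i
    simp only [Function.comp, Pi.add_apply]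
    congr 1
    by_cases h1 : i = a
    · subst h1; simp [va, vb]
    by_cases h2 : i = b
    · subst h2; simp [va, vb]
    rw [Equiv.swap_apply_of_ne_of_ne h1 h2]

end kap
end HLHecke

namespace HLHecke

section orb
variable {n : ℕ}

lemma Tw_stab_comm (μ : Fin n → ℤ) (hμ : Antitone μ) (h0 : ∀ i, 0 ≤ μ i)
    (w : Equiv.Perm (Fin n)) : wAct n w μ = μ → Tw n w * Xmon n μ = Xmon n μ * Tw n w := by
  induction w using perm_induction with
  | h1 => intro _; rw [Tw_one, one_mul, mul_one]
  | hs w a b h hw ih =>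
    intro hst
    have e1 := congrFun hst a
    have e2 := congrFun hst b
    simp only [wAct] at e1 e2
    rw [smul_inv_a w a b h] at e1
    rw [smul_inv_b w a b h] at e2
    have hab : a ≤ b := by rw [Fin.le_def]; omega
    have h3 := hμ hab
    have h4 := hμ hw.le
    have he : μ a = μ b := by omega
    have hst' : wAct n w μ = μ := by
      funext c
      simp only [wAct]
      by_cases h1 : c = a
      · subst h1; omega
      by_cases h2 : c = b
      · subst h2; omega
      have := congrFun hst c
      simp only [wAct] at this
      rwa [smul_inv_c w a b c h h1 h2] at this
    rw [Tw_asc w a b h hw, mul_assoc, ih hst', ← mul_assoc, T_Xmon_eq a b h μ h0 he, mul_assoc]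

/-- fiber sum -/
def Yt (lam κ : Fin n → ℤ) : H n :=
  ∑ w ∈ Finset.univ.filter (fun w : Equiv.Perm (Fin n) => wAct n w lam = κ),
    Tw n w * (Xmon n lam * one0 n)

lemma Yt_self (lam : Fin n → ℤ) (hA : Antitone lam) (h0 : ∀ i, 0 ≤ lam i) :
    Yt lam lam = Wlam n lam • Yk lam := by
  unfold Yt Wlam
  rw [Yk_anti _ hA, Finset.sum_smul]
  apply Finset.sum_congr rfl
  intro w hw
  rw [Finset.mem_filter] at hw
  rw [← mul_assoc, Tw_stab_comm lam hA h0 w hw.2, mul_assoc, Tw_one0, mul_smul_comm]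

lemma wAct_swap (lam : Fin n → ℤ) (w : Equiv.Perm (Fin n)) (a b : Fin n) (h : (a : ℕ) + 1 = b) :
    wAct n (sgen n a * w) lam = wAct n w lam ∘ Equiv.swap a b := by
  funext i
  simp [wAct, sgen_eq a b h]

lemma Yt_up (lam κ : Fin n → ℤ) (hA : Antitone lam) (a b : Fin n) (h : (a : ℕ) + 1 = b)
    (hκ : κ b < κ a) : Tg n a * Yt lam κ = Yt lam (κ ∘ Equiv.swap a b) := by
  unfold Yt
  rw [Finset.mul_sum]
  refine Finset.sum_bij' (fun w _ => sgen n a * w) (fun w _ => sgen n a * w) ?_ ?_ ?_ ?_ ?_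
  · intro w hw
    rw [Finset.mem_filter] at *
    refine ⟨Finset.mem_univ _, ?_⟩
    rw [wAct_swap _ _ a b h, hw.2]
  · intro w hw
    rw [Finset.mem_filter] at *
    refine ⟨Finset.mem_univ _, ?_⟩
    rw [wAct_swap _ _ a b h, hw.2, comp_swap_swap]
  · intro w _; exact sgen_mul_cancel _ _
  · intro w _; exact sgen_mul_cancel _ _
  · intro w hw
    rw [Finset.mem_filter] at hw
    have hasc : w⁻¹ a < w⁻¹ b := by
      by_contra hc
      push Not at hc
      have := hA hc
      rw [← hw.2] at hκ
      simp only [wAct] at hκ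
      omega
    rw [Tw_asc w a b h hasc, mul_assoc]

/-- number of `i` with `κ i > m` -/
def cgt (κ : Fin n → ℤ) (m : ℕ) : ℕ := (Finset.univ.filter fun i : Fin n => (m : ℤ) < κ i).card

lemma cgt_perm (κ : Fin n → ℤ) (σ : Equiv.Perm (Fin n)) (m : ℕ) : cgt (κ ∘ σ) m = cgt κ m := by
  unfold cgt
  apply Finset.card_bij (fun i _ => σ i)
  · intro i hi; simpa using hi
  · intro i _ j _ hij; exact σ.injective hij
  · intro j hj; exact ⟨σ⁻¹ j, by simpa using hj, by simp⟩

def Ob (c : ℕ → ℕ) (k : ℕ) : Finset (Fin n → ℤ) :=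
  (Fintype.piFinset fun _ : Fin n => Finset.Icc (0 : ℤ) k).filter fun κ => ∀ m < k, cgt κ m = c m

lemma mem_Ob (c : ℕ → ℕ) (k : ℕ) (κ : Fin n → ℤ) :
    κ ∈ Ob c k ↔ (∀ i, 0 ≤ κ i ∧ κ i ≤ k) ∧ ∀ m < k, cgt κ m = c m := by
  simp [Ob]

lemma Ob_perm (c : ℕ → ℕ) (k : ℕ) (κ : Fin n → ℤ) (σ : Equiv.Perm (Fin n)) :
    κ ∘ σ ∈ Ob c k ↔ κ ∈ Ob c k := by
  rw [mem_Ob, mem_Ob]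
  simp only [cgt_perm]
  constructor
  · rintro ⟨h1, h2⟩; exact ⟨fun i => by simpa using h1 (σ⁻¹ i), h2⟩
  · rintro ⟨h1, h2⟩; exact ⟨fun i => h1 (σ i), h2⟩

lemma anti_cgt (κ : Fin n → ℤ) (h : Antitone κ) (m : ℕ) (i : Fin n) :
    (m : ℤ) < κ i ↔ (i : ℕ) < cgt κ m := by
  rw [cgt]
  exact (Tuple.lt_card_gt_iff_apply_gt_of_antitone (j := i) h).symm

lemma Ob_anti (c : ℕ → ℕ) (k : ℕ) (κ μ : Fin n → ℤ) (hκ : κ ∈ Ob c k) (hμ : μ ∈ Ob c k)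
    (h1 : Antitone κ) (h2 : Antitone μ) : κ = μ := by
  rw [mem_Ob] at hκ hμ
  have key : ∀ i, ∀ m : ℕ, (m : ℤ) < κ i ↔ (m : ℤ) < μ i := by
    intro i m
    by_cases hm : m < k
    · rw [anti_cgt κ h1, anti_cgt μ h2, hκ.2 m hm, hμ.2 m hm]
    · have := (hκ.1 i).2
      have := (hμ.1 i).2
      omega
  funext i
  have a1 := (hκ.1 i).1
  have a2 := (hμ.1 i).1
  have k1 := key i (κ i).toNat
  have k2 := key i (μ i).toNat
  rw [Int.toNat_of_nonneg a1] at k1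
  rw [Int.toNat_of_nonneg a2] at k2
  omega

lemma Yt_eq (lam : Fin n → ℤ) (hA : Antitone lam) (c : ℕ → ℕ) (k : ℕ) (hl : lam ∈ Ob c k)
    (κ : Fin n → ℤ) (hκ : κ ∈ Ob c k) : Yt lam κ = Wlam n lam • Yk κ := by
  have h0 := fun i => (((mem_Ob c k κ).mp hκ).1 i).1
  revert hκ
  refine kind (P := fun κ => κ ∈ Ob c k → Yt lam κ = Wlam n lam • Yk κ) ?_ ?_ κ h0
  · intro κ _ hκA hκ
    rw [Ob_anti c k κ lam hκ hl hκA hA]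
    exact Yt_self lam hA (fun i => (((mem_Ob c k lam).mp hl).1 i).1)
  · intro κ a b hab _ hlt ih hκ
    rw [Ob_perm] at hκ
    rw [← Yt_up lam κ hA a b hab hlt, ih hκ, mul_smul_comm, Yk_up κ a b hab hlt]

lemma one0_X_one0 (lam : Fin n → ℤ) (hA : Antitone lam) (c : ℕ → ℕ) (k : ℕ)
    (hl : lam ∈ Ob c k) :
    one0 n * Xmon n lam * one0 n = Wlam n lam • ∑ κ ∈ Ob c k, Yk κ := by
  rw [mul_assoc]
  conv_lhs => rw [show one0 n * (Xmon n lam * one0 n) =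
    ∑ w : Equiv.Perm (Fin n), Tw n w * (Xmon n lam * one0 n) from Finset.sum_mul _ _ _]
  rw [Finset.smul_sum, ← Finset.sum_fiberwise_of_maps_to (t := Ob c k) (g := fun w => wAct n w lam)]
  · apply Finset.sum_congr rfl
    intro κ hκ
    exact Yt_eq lam hA c k hl κ hκ
  · intro w _
    exact (Ob_perm c k lam w⁻¹).mpr hl

end orb
end HLHecke

namespace HLHecke

section zz
variable {n : ℕ}

def Zf (c : ℕ → ℕ) : ℕ → Finset (Fin n) → H n
  | 0, _ => one0 n
  | j + 1, E => ∑ F ∈ colFinset n (c j), aC F E • (Xmon n (vecOf n F) * Zf c j F)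

lemma Zf_ruleV (c : ℕ → ℕ) (j e : ℕ) : RuleV e (Zf (n := n) c j) := by
  induction j generalizing e with
  | zero =>
    intro a b F h _
    exact ⟨fun _ _ => Tg_one0 a b h, fun _ => Tg_one0 a b h⟩
  | succ j ih =>
    exact ruleV_of_ruleY (c j) e _ (ruleY_of_ruleV (c j) _ (ih (c j)))

/-- columns of `κ'` with top value -/
def topSet (j : ℕ) (κ : Fin n → ℤ) : Finset (Fin n) :=
  Finset.univ.filter fun i : Fin n => (j : ℤ) < κ i

lemma mem_topSet (j : ℕ) (κ : Fin n → ℤ) (i : Fin n) : i ∈ topSet j κ ↔ (j : ℤ) < κ i := by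
  simp [topSet]

def yt (c : ℕ → ℕ) (j : ℕ) (F : Finset (Fin n)) : H n :=
  ∑ κ ∈ (Ob c (j + 1)).filter (fun κ => topSet j κ = F), Yk κ

lemma topSet_swap (j : ℕ) (κ : Fin n → ℤ) (a b : Fin n) :
    topSet j (κ ∘ Equiv.swap a b) = sw a b (topSet j κ) := by
  ext i; rw [mem_sw, mem_topSet, mem_topSet]; rfl

lemma yt_up (c : ℕ → ℕ) (j : ℕ) (F : Finset (Fin n)) (a b : Fin n) (h : (a : ℕ) + 1 = b)
    (ha : a ∈ F) (hb : b ∉ F) : Tg n a * yt c j F = yt c j (sw a b F) := by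
  unfold yt
  rw [Finset.mul_sum]
  refine Finset.sum_bij' (fun κ _ => κ ∘ Equiv.swap a b) (fun κ _ => κ ∘ Equiv.swap a b) ?_ ?_ ?_ ?_ ?_
  · intro κ hκ
    rw [Finset.mem_filter] at *
    rw [Ob_perm, topSet_swap, hκ.2]
    exact ⟨hκ.1, rfl⟩
  · intro κ hκ
    rw [Finset.mem_filter] at *
    rw [Ob_perm, topSet_swap, hκ.2, sw_sw]
    exact ⟨hκ.1, rfl⟩
  · intro κ _; exact comp_swap_swap _ _ _
  · intro κ _; exact comp_swap_swap _ _ _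
  · intro κ hκ
    rw [Finset.mem_filter] at hκ
    apply Yk_up κ a b h
    rw [← hκ.2, mem_topSet] at ha hb
    omega

lemma mem_hwCol (f : ℕ) (i : Fin n) : i ∈ hwCol n f ↔ (i : ℕ) < f := by simp [hwCol]

lemma card_hwCol (f : ℕ) (hf : f ≤ n) : (hwCol n f).card = f := by
  have : hwCol n f = (Finset.univ : Finset (Fin f)).map (Fin.castLEEmb hf) := by
    ext i
    rw [mem_hwCol]
    simp only [Finset.mem_map, Finset.mem_univ, true_and]
    constructor
    · intro h; exact ⟨⟨i, h⟩, by ext; rfl⟩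
    · rintro ⟨x, rfl⟩; exact x.2
  rw [this, Finset.card_map, Finset.card_univ, Fintype.card_fin]

lemma vecOf_hwCol (f : ℕ) : vecOf n (hwCol n f) = varpi n f := by
  funext i; simp [vecOf, varpi, mem_hwCol]

lemma vecOf_inj (F G : Finset (Fin n)) (h : vecOf n F = vecOf n G) : F = G := by
  ext i
  have := congrFun h i
  simp only [vecOf] at this
  split_ifs at this <;> tauto

lemma vecOf_anti (F : Finset (Fin n)) (h : Antitone (vecOf n F)) : F = hwCol n F.card := by
  ext i
  have := anti_cgt _ h 0 i
  rw [mem_hwCol]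
  have e : cgt (vecOf n F) 0 = F.card := by
    unfold cgt; congr 1; ext x; simp only [Finset.mem_filter, Finset.mem_univ, true_and]; simp only [vecOf]; split_ifs <;> simp [*]
  rw [e] at this
  rw [← this]
  simp only [vecOf]; split_ifs <;> simp [*]

lemma col_induction {P : Finset (Fin n) → Prop} (f : ℕ) (h0 : P (hwCol n f))
    (hs : ∀ F (a b : Fin n), (a : ℕ) + 1 = b → F.card = f → a ∈ F → b ∉ F → P F → P (sw a b F)) :
    ∀ F, F.card = f → P F := by
  intro F hF
  have := kind (P := fun κ => ∀ F : Finset (Fin n), vecOf n F = κ → F.card = f → P F) ?_ ?_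
    (vecOf n F) (vecOf_nonneg F) F rfl hF
  · exact this
  · intro κ _ hA F hFκ hF
    subst hFκ
    rw [vecOf_anti F hA, hF]; exact h0
  · intro κ a b hab _ hlt ih F hFκ hF
    have e : vecOf n (sw a b F) = κ := by rw [vecOf_sw, hFκ, comp_swap_swap]
    have ha : a ∈ sw a b F ∧ b ∉ sw a b F := by
      rw [← e] at hlt
      simp only [vecOf] at hlt
      split_ifs at hlt <;> first | omega | (constructor <;> assumption)
    have := hs (sw a b F) a b hab (by rw [card_sw, hF]) ha.1 ha.2 (ih _ e (by rw [card_sw, hF]))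
    rwa [sw_sw] at this

lemma aC_hw (F : Finset (Fin n)) (e : ℕ) :
    aC F (hwCol n e) = if hwCol n e ⊆ F then 1 else 0 := by
  split_ifs with h
  · apply Finset.prod_eq_one
    intro x _
    unfold fac
    rw [if_neg]
    rintro ⟨h1, h2⟩; exact h1 (h h2)
  · obtain ⟨x, hx, hxF⟩ := Finset.not_subset.mp h
    rw [mem_hwCol] at hx
    have : cnt F ((x : ℕ) + 1) < cnt (hwCol n e) ((x : ℕ) + 1) := by
      unfold cnt
      apply Finset.card_lt_card
      rw [Finset.ssubset_iff_of_subset]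
      · refine ⟨x, by simp [mem_hwCol, hx], by simp [hxF]⟩
      · intro y hy
        simp only [Finset.mem_filter, mem_hwCol] at *
        omega
    obtain ⟨y, -, hy⟩ := exists_fac_zero _ _ _ this
    exact Finset.prod_eq_zero (Finset.mem_univ y) hy

lemma Ob_zero (c : ℕ → ℕ) : Ob (n := n) c 0 = {0} := by
  ext κ
  rw [mem_Ob, Finset.mem_singleton]
  constructor
  · rintro ⟨h, -⟩
    funext i
    have := h i
    simp at this ⊢; omega
  · rintro rfl; simp

lemma y_hw (c : ℕ → ℕ) (hc : ∀ j, c j ≤ n) (j : ℕ) :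
    ∑ κ ∈ (Ob (n := n) c j).filter (fun κ : Fin n → ℤ => ∀ i : Fin n, (i : ℕ) < c j → κ i = (j : ℤ)),
      Xmon n (varpi n (c j)) * Yk κ = yt c j (hwCol n (c j)) := by
  unfold yt
  refine Finset.sum_bij' (fun κ _ => κ + varpi n (c j)) (fun κ _ => κ - varpi n (c j)) ?_ ?_ ?_ ?_ ?_
  · intro κ hκ
    rw [Finset.mem_filter, mem_Ob] at *
    obtain ⟨⟨h1, h2⟩, h3⟩ := hκ
    have top : topSet j (κ + varpi n (c j)) = hwCol n (c j) := by
      ext i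
      rw [mem_topSet, mem_hwCol]
      have := h1 i
      have := h3 i
      simp only [Pi.add_apply, varpi]
      split_ifs <;> omega
    refine ⟨⟨?_, ?_⟩, top⟩
    · intro i
      have := h1 i
      simp only [Pi.add_apply, varpi]
      push_cast
      split_ifs <;> omega
    · intro m hm
      by_cases hmj : m = j
      · subst hmj
        have := congrArg Finset.card top
        rw [card_hwCol _ (hc m)] at this
        exact this
      · rw [← h2 m (by omega)]
        unfold cgt
        congr 1
        ext i
        simp only [Finset.mem_filter, Finset.mem_univ, true_and]; simp only [Pi.add_apply, varpi]
        have := h3 i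
        split_ifs <;> omega
  · intro κ hκ
    rw [Finset.mem_filter, mem_Ob] at *
    obtain ⟨⟨h1, h2⟩, h3⟩ := hκ
    have top : ∀ i : Fin n, (j : ℤ) < κ i ↔ (i : ℕ) < c j := by
      intro i
      rw [← mem_topSet, h3, mem_hwCol]
    push_cast at h1
    refine ⟨⟨?_, ?_⟩, ?_⟩
    · intro i
      have := h1 i
      have := top i
      simp only [Pi.sub_apply, varpi]
      split_ifs <;> omega
    · intro m hm
      rw [← h2 m (by omega)]
      unfold cgt
      congr 1
      ext i
      simp only [Finset.mem_filter, Finset.mem_univ, true_and]; simp only [Pi.sub_apply, varpi]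
      have := top i
      split_ifs <;> omega
    · intro i hi
      have := h1 i
      have := top i
      simp only [Pi.sub_apply, varpi]
      split_ifs <;> omega
  · intro κ _; simp
  · intro κ _; simp
  · intro κ hκ
    rw [Finset.mem_filter, mem_Ob] at hκ
    apply Yk_shift
    · intro i; exact (hκ.1.1 i).1
    · intro i hi k
      rw [hκ.2 i hi]; exact (hκ.1.1 k).2

theorem Zf_hw (c : ℕ → ℕ) (hc : ∀ j, c j ≤ n) (j e : ℕ) :
    Zf (n := n) c j (hwCol n e) =
      ∑ κ ∈ (Ob (n := n) c j).filter (fun κ : Fin n → ℤ => ∀ i : Fin n, (i : ℕ) < e → κ i = (j : ℤ)), Yk κ := by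
  induction j generalizing e with
  | zero =>
    rw [Ob_zero, Finset.filter_true_of_mem (by simp)]
    rw [Finset.sum_singleton, Yk_anti 0 (fun _ _ _ => le_refl _), Xmon_zero, one_mul]
    rfl
  | succ j ih =>
    have hy : ∀ F : Finset (Fin n), F.card = c j → Xmon n (vecOf n F) * Zf c j F = yt c j F := by
      apply col_induction
      · rw [vecOf_hwCol, ih, ← y_hw c hc, Finset.mul_sum]
      · intro F a b hab hF ha hb hP
        rw [← yt_up c j F a b hab ha hb, ← hP]
        have := ((ruleY_of_ruleV (c j) _ (Zf_ruleV c j (c j))) a b F hab hF).1 ha hb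
        exact this.symm
    have e1 : Zf (n := n) c (j + 1) (hwCol n e) =
        ∑ F ∈ colFinset n (c j), if hwCol n e ⊆ F then yt c j F else 0 := by
      rw [Zf]
      apply Finset.sum_congr rfl
      intro F hF
      rw [hy F (by simpa [colFinset] using hF), aC_hw]
      split_ifs <;> simp
    rw [e1, ← Finset.sum_filter]
    rw [← Finset.sum_fiberwise_of_maps_to (g := fun κ => topSet j κ)
      (t := (colFinset n (c j)).filter fun F => hwCol n e ⊆ F)]
    · apply Finset.sum_congr rfl
      intro F hF
      rw [Finset.mem_filter] at hF
      unfold yt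
      apply Finset.sum_congr _ (fun _ _ => rfl)
      ext κ
      simp only [Finset.mem_filter]
      constructor
      · rintro ⟨h1, h2⟩
        refine ⟨⟨h1, ?_⟩, h2⟩
        intro i hi
        have hi' := hF.2 ((mem_hwCol e i).mpr hi)
        rw [← h2, mem_topSet] at hi'
        have := (((mem_Ob _ _ _).mp h1).1 i).2
        push_cast at *
        omega
      · rintro ⟨⟨h1, -⟩, h2⟩; exact ⟨h1, h2⟩
    · intro κ hκ
      rw [Finset.mem_filter] at *
      constructor
      · simp only [colFinset, Finset.mem_filter, Finset.mem_univ, true_and]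
        exact ((mem_Ob _ _ _).mp hκ.1).2 j (by omega)
      · intro i hi
        rw [mem_topSet, hκ.2 i ((mem_hwCol e i).mp hi)]
        push_cast; omega

lemma Zf_empty (c : ℕ → ℕ) (hc : ∀ j, c j ≤ n) (k : ℕ) :
    Zf (n := n) c k ∅ = ∑ κ ∈ Ob c k, Yk κ := by
  have e : hwCol n 0 = ∅ := by ext i; simp [mem_hwCol]
  rw [← e, Zf_hw c hc, Finset.filter_true_of_mem (by simp)]

end zz
end HLHecke

namespace HLHecke

section tab
variable {n : ℕ}

lemma sum_vec_nonneg {k : ℕ} (f : Fin k → Finset (Fin n)) :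
    ∀ i, 0 ≤ (∑ p, vecOf n (f p)) i := by
  intro i
  rw [Finset.sum_apply]
  exact Finset.sum_nonneg fun p _ => vecOf_nonneg _ i

/-- next column, with `E` after the last one -/
def nxt {k : ℕ} (f : Fin k → Finset (Fin n)) (E : Finset (Fin n)) : Fin (k + 1) → Finset (Fin n) :=
  Fin.snoc (α := fun _ => Finset (Fin n)) f E

lemma nxt_castSucc {k : ℕ} (f : Fin k → Finset (Fin n)) (E : Finset (Fin n)) (p : Fin k) :
    nxt f E p.castSucc = f p := by
  unfold nxt; rw [Fin.snoc_castSucc]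

lemma nxt_last {k : ℕ} (f : Fin k → Finset (Fin n)) (E : Finset (Fin n)) :
    nxt f E (Fin.last k) = E := by
  unfold nxt; rw [Fin.snoc_last]

def cf {k : ℕ} (f : Fin k → Finset (Fin n)) (E : Finset (Fin n)) : HR :=
  ∏ p : Fin k, aC (f p) (nxt f E p.succ)

lemma cf_snoc {k : ℕ} (f : Fin k → Finset (Fin n)) (F E : Finset (Fin n)) :
    cf (nxt f F) E = cf f F * aC F E := by
  unfold cf
  rw [Fin.prod_univ_castSucc]
  congr 1
  · apply Finset.prod_congr rfl
    intro p _
    rw [nxt_castSucc, Fin.succ_castSucc, nxt_castSucc]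
  · rw [nxt_last, Fin.succ_last, nxt_last]

lemma Zf_expand (c : ℕ → ℕ) (k : ℕ) (E : Finset (Fin n)) :
    Zf c k E = ∑ f ∈ Fintype.piFinset (fun j : Fin k => colFinset n (c j)),
      cf f E • (Xmon n (∑ p, vecOf n (f p)) * one0 n) := by
  induction k generalizing E with
  | zero =>
    have e : Fintype.piFinset (fun j : Fin 0 => colFinset n (c j)) = {fun p => p.elim0} := by
      ext f
      rw [Fintype.mem_piFinset, Finset.mem_singleton]
      exact ⟨fun _ => funext fun p => p.elim0, fun _ p => p.elim0⟩
    rw [e, Finset.sum_singleton]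
    simp [cf, Zf, Xmon_zero]
  | succ k ih =>
    rw [Zf]
    simp_rw [ih, Finset.mul_sum, Finset.smul_sum]
    rw [Finset.sum_sigma']
    refine Finset.sum_bij' (fun x _ => nxt x.2 x.1)
      (fun f _ => ⟨f (Fin.last k), fun p => f p.castSucc⟩) ?_ ?_ ?_ ?_ ?_
    · rintro ⟨F, f⟩ hf
      rw [Finset.mem_sigma, Fintype.mem_piFinset] at hf
      rw [Fintype.mem_piFinset]
      intro j
      induction j using Fin.lastCases with
      | last => rw [nxt_last]; exact hf.1
      | cast j => rw [nxt_castSucc]; exact hf.2 j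
    · intro f hf
      rw [Fintype.mem_piFinset] at hf
      rw [Finset.mem_sigma, Fintype.mem_piFinset]
      exact ⟨hf _, fun j => hf j.castSucc⟩
    · rintro ⟨F, f⟩ _
      simp only [nxt_last, nxt_castSucc]
    · intro f _
      funext j
      induction j using Fin.lastCases with
      | last => rw [nxt_last]
      | cast j => rw [nxt_castSucc]
    · rintro ⟨F, f⟩ _
      simp only
      rw [cf_snoc, Fin.sum_univ_castSucc]
      simp only [nxt_last, nxt_castSucc]
      rw [add_comm, Xmon_add _ _ (vecOf_nonneg F) (sum_vec_nonneg f), mul_smul_comm, smul_smul,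
        mul_comm (cf f F), mul_assoc]

lemma wtVec_ofFn {k : ℕ} (f : Fin k → Finset (Fin n)) :
    wtVec n (List.ofFn f) = ∑ p, vecOf n (f p) := by
  have gen : ∀ L : List (Finset (Fin n)), wtVec n L = (L.map (vecOf n)).sum := by
    intro L
    induction L with
    | nil => funext i; simp [wtVec]
    | cons C L ih =>
      rw [List.map_cons, List.sum_cons, ← ih]
      funext i
      simp only [wtVec, List.filter_cons, Pi.add_apply, vecOf]
      by_cases h : i ∈ C <;> simp [h, add_comm]
  rw [gen, List.map_ofFn, List.sum_ofFn]
  rfl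

lemma colCount_eq (L : List (Finset (Fin n))) (i p : ℕ) :
    colCount n L i p = cnt (L.getD p ∅) i := by
  unfold colCount cnt
  symm
  apply Finset.card_bij (fun (x : Fin n) _ => (x : ℕ))
  · intro x hx
    simp only [Finset.mem_filter, Finset.bind_def, Finset.mem_sup, Finset.pure_def,
      Finset.mem_singleton] at *
    exact ⟨⟨x, hx.1, rfl⟩, hx.2⟩
  · intro x _ y _ h; exact Fin.ext h
  · intro y hy
    simp only [Finset.mem_filter, Finset.bind_def, Finset.mem_sup, Finset.pure_def,
      Finset.mem_singleton] at hy
    obtain ⟨⟨x, hx, rfl⟩, h2⟩ := hy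
    exact ⟨x, by simp only [Finset.mem_filter]; exact ⟨hx, h2⟩, rfl⟩

def phi (F E : Finset (Fin n)) (i : ℕ) : HR :=
  if cnt F (i + 1) = cnt F i ∧ cnt E (i + 1) = cnt E i + 1 then 1 - tt ^ (cnt F i - cnt E i) else 1

lemma phi_fac (F E : Finset (Fin n)) (x : Fin n) : phi F E x = fac F E x := by
  unfold phi fac
  rw [cnt_succ, cnt_succ]
  by_cases h1 : x ∈ F <;> by_cases h2 : x ∈ E <;> simp [h1, h2]

lemma aC_phi (F E : Finset (Fin n)) : aC F E = ∏ i ∈ Finset.range n, phi F E i := by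
  rw [Finset.prod_range]
  exact Finset.prod_congr rfl fun x _ => (phi_fac F E x).symm

lemma aC_Ico (hn : 1 ≤ n) (F E : Finset (Fin n)) (h : ∀ i, cnt E i ≤ cnt F i) :
    ∏ i ∈ Finset.Ico 1 n, phi F E i = aC F E := by
  rw [aC_phi, Finset.range_eq_Ico, Finset.prod_eq_prod_Ico_succ_bot (a := 0) (b := n) (by omega)]
  have : phi F E 0 = 1 := by
    unfold phi
    rw [if_neg]
    rintro ⟨h1, h2⟩
    have := h 1
    simp only [cnt_zero, zero_add] at *
    omega
  rw [this, one_mul]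

lemma getD_ofFn {k : ℕ} (f : Fin k → Finset (Fin n)) (p : Fin (k + 1)) :
    (List.ofFn f).getD p ∅ = nxt f ∅ p := by
  induction p using Fin.lastCases with
  | last => rw [nxt_last]; simp
  | cast j => rw [nxt_castSucc]; simp

lemma macPsi_eq (hn : 1 ≤ n) {k : ℕ} (f : Fin k → Finset (Fin n))
    (h : ∀ (p : Fin k) i, cnt (nxt f ∅ p.succ) i ≤ cnt (f p) i) :
    macPsi n (List.ofFn f) = cf f ∅ := by
  unfold macPsi cf
  have e : ∀ i, stripFactor n (List.ofFn f) i = ∏ p : Fin k, phi (f p) (nxt f ∅ p.succ) i := by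
    intro i
    unfold stripFactor
    rw [List.length_ofFn, Finset.prod_range]
    apply Finset.prod_congr rfl
    intro p _
    simp only [colCount_eq]
    have e1 := getD_ofFn f p.castSucc
    have e2 := getD_ofFn f p.succ
    rw [nxt_castSucc] at e1
    simp only [Fin.val_castSucc, Fin.val_succ] at e1 e2
    rw [e1, e2]
    rfl
  simp only [e]
  rw [Finset.prod_comm]
  apply Finset.prod_congr rfl
  intro p _
  exact aC_Ico hn _ _ (h p)

lemma nth_lt (F : Finset (Fin n)) (k i : ℕ) (hk : k < F.card) :
    nth n F k < i ↔ k < cnt F i := by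
  have e : nth n F k = (F.orderEmbOfFin rfl ⟨k, hk⟩ : ℕ) := by
    rw [Finset.orderEmbOfFin_apply]
    unfold nth
    simp [List.getD_eq_getElem?_getD, hk]
  have hm : Monotone fun j : Fin F.card => (F.orderEmbOfFin rfl j : ℕ) := by
    intro a b hab
    exact (F.orderEmbOfFin rfl).monotone hab
  have key := Tuple.lt_card_lt_iff_apply_lt_of_monotone (j := ⟨k, hk⟩) (a := i) hm
  rw [e, ← key]
  have : cnt F i = (Finset.univ.filter fun j : Fin F.card => (F.orderEmbOfFin rfl j : ℕ) < i).card := by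
    unfold cnt
    symm
    apply Finset.card_bij (fun j _ => F.orderEmbOfFin rfl j)
    · intro j hj
      rw [Finset.mem_filter] at *
      exact ⟨F.orderEmbOfFin_mem rfl j, hj.2⟩
    · intro a _ b _ hab; exact (F.orderEmbOfFin rfl).injective hab
    · intro x hx
      rw [Finset.mem_filter] at hx
      have : x ∈ Set.range (F.orderEmbOfFin rfl) := by
        rw [Finset.range_orderEmbOfFin]; exact hx.1
      obtain ⟨j, rfl⟩ := this
      exact ⟨j, by rw [Finset.mem_filter]; exact ⟨Finset.mem_univ _, hx.2⟩, rfl⟩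
  rw [this]

lemma cnt_le_card (F : Finset (Fin n)) (i : ℕ) : cnt F i ≤ F.card := Finset.card_filter_le _ _

lemma pairSS_iff (F E : Finset (Fin n)) (h : E.card ≤ F.card) :
    pairSS n F E ↔ ∀ i, cnt E i ≤ cnt F i := by
  constructor
  · intro hss i
    by_contra hc
    push Not at hc
    have h1 := cnt_le_card E i
    have h2 := hss (cnt F i) (by omega)
    have h3 := (nth_lt E (cnt F i) i (by omega)).mpr hc
    have h4 := (nth_lt F (cnt F i) i (by omega)).mp (by omega)
    omega
  · intro hss k hk
    have h1 := (nth_lt E k (nth n E k + 1) hk).mp (by omega)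
    have h2 := hss (nth n E k + 1)
    have h3 := (nth_lt F k (nth n E k + 1) (by omega)).mpr (by omega)
    omega

lemma cnt_empty (i : ℕ) : cnt (∅ : Finset (Fin n)) i = 0 := by simp [cnt]

lemma nxt_lt {k : ℕ} (f : Fin k → Finset (Fin n)) (E : Finset (Fin n)) (p : ℕ) (hp : p + 1 < k) :
    nxt f E (⟨p, by omega⟩ : Fin k).succ = f ⟨p + 1, hp⟩ := by
  rw [← nxt_castSucc f E]; rfl

lemma isSSYT_iff {k : ℕ} (f : Fin k → Finset (Fin n)) (c : ℕ → ℕ) (hc : Antitone c)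
    (hf : ∀ j : Fin k, (f j).card = c j) :
    isSSYT n (List.ofFn f) ↔ ∀ (p : Fin k) i, cnt (nxt f ∅ p.succ) i ≤ cnt (f p) i := by
  have h1 : isSSYT n (List.ofFn f) ↔
      ∀ (p : ℕ) (hp : p + 1 < k), pairSS n (f ⟨p, by omega⟩) (f ⟨p + 1, hp⟩) := List.isChain_ofFn
  have h2 : ∀ (p : ℕ) (hp : p + 1 < k), pairSS n (f ⟨p, by omega⟩) (f ⟨p + 1, hp⟩) ↔
      ∀ i, cnt (f ⟨p + 1, hp⟩) i ≤ cnt (f ⟨p, by omega⟩) i := by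
    intro p hp
    apply pairSS_iff
    rw [hf, hf]
    exact hc (by simp)
  rw [h1]
  constructor
  · intro h ⟨p, hpk⟩ i
    by_cases hp : p + 1 < k
    · rw [nxt_lt f ∅ p hp]
      exact (h2 p hp).mp (h p hp) i
    · have : (⟨p, hpk⟩ : Fin k).succ = Fin.last k := by ext; simp; omega
      rw [this, nxt_last, cnt_empty]
      exact Nat.zero_le _
  · intro h p hp
    rw [h2 p hp]
    intro i
    rw [← nxt_lt f ∅ p hp]
    exact h _ i

lemma psiT_eq (hn : 1 ≤ n) {k : ℕ} (f : Fin k → Finset (Fin n)) (c : ℕ → ℕ) (hc : Antitone c)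
    (hf : ∀ j : Fin k, (f j).card = c j) : psiT n (List.ofFn f) = cf f ∅ := by
  unfold psiT
  split_ifs with h
  · exact macPsi_eq hn f ((isSSYT_iff f c hc hf).mp h)
  · rw [isSSYT_iff f c hc hf] at h
    push Not at h
    obtain ⟨p, i, hpi⟩ := h
    obtain ⟨x, -, hx⟩ := exists_fac_zero _ _ _ hpi
    symm
    apply Finset.prod_eq_zero (Finset.mem_univ p)
    exact Finset.prod_eq_zero (Finset.mem_univ x) hx

lemma lam_mem (lam : Fin n → ℤ) (h0 : ∀ i, 0 ≤ lam i) :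
    lam ∈ Ob (shapeColLen n lam) (numCols n lam) := by
  rw [mem_Ob]
  refine ⟨fun i => ⟨h0 i, ?_⟩, fun m _ => rfl⟩
  have : (lam i).toNat ≤ numCols n lam :=
    Finset.le_sup (f := fun i : Fin n => (lam i).toNat) (Finset.mem_univ i)
  omega

lemma shape_anti (lam : Fin n → ℤ) : Antitone (shapeColLen n lam) := by
  intro a b hab
  apply Finset.card_le_card
  intro i hi
  rw [Finset.mem_filter] at *
  exact ⟨hi.1, by omega⟩

lemma shape_le (lam : Fin n → ℤ) (j : ℕ) : shapeColLen n lam j ≤ n := col_card_le n _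

end tab
end HLHecke

namespace HLHecke

/-- Macdonald's formula, as an identity in the affine Hecke algebra:
`1₀ X^λ 1₀ = W_λ(t) Σ_{T ∈ B(λ)} ψ_T X^T 1₀`, the sum over all semistandard Young tableaux
of shape `λ` with entries in `[n]` (encoded as their sequences of columns, leftmost first).
Dividing by `W_λ(t)`, this says the Hall–Littlewood polynomial `P_λ(t)` equals
`Σ_{T ∈ B(λ)} ψ_T X^T`. -/
theorem stmt19 (n : ℕ) (hn : 1 ≤ n) (lam : Fin n → ℤ)
    (hdom : Antitone lam) (hnonneg : ∀ i, 0 ≤ lam i) :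
    one0 n * Xmon n lam * one0 n
      = algebraMap HR (H n) (Wlam n lam) *
          ∑ f ∈ Finset.univ.filter
            (fun f : Fin (numCols n lam) → Finset (Fin n) =>
              (∀ j : Fin (numCols n lam), (f j).card = shapeColLen n lam (j : ℕ)) ∧
              isSSYT n (List.ofFn f)),
            algebraMap HR (H n) (psiT n (List.ofFn f)) *
              Xmon n (wtVec n (List.ofFn f)) * one0 n := by
  rw [one0_X_one0 lam hdom _ _ (lam_mem lam hnonneg), ← Zf_empty _ (shape_le lam), Zf_expand,
    Algebra.smul_def]
  congr 1
  have e : (Finset.univ.filter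
      (fun f : Fin (numCols n lam) → Finset (Fin n) =>
        (∀ j : Fin (numCols n lam), (f j).card = shapeColLen n lam (j : ℕ)) ∧
        isSSYT n (List.ofFn f))) ⊆
      Fintype.piFinset (fun j : Fin (numCols n lam) => colFinset n (shapeColLen n lam j)) := by
    intro f hf
    rw [Finset.mem_filter] at hf
    rw [Fintype.mem_piFinset]
    intro j
    rw [colFinset, Finset.mem_filter]
    exact ⟨Finset.mem_univ _, hf.2.1 j⟩
  symm
  have card : ∀ f ∈ Fintype.piFinset
      (fun j : Fin (numCols n lam) => colFinset n (shapeColLen n lam j)),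
      ∀ j, (f j).card = shapeColLen n lam (j : ℕ) := by
    intro f hf j
    have := (Fintype.mem_piFinset.mp hf) j
    rw [colFinset, Finset.mem_filter] at this
    exact this.2
  rw [Finset.sum_subset e]
  · apply Finset.sum_congr rfl
    intro f hf
    rw [psiT_eq hn f _ (shape_anti lam) (card f hf), wtVec_ofFn, Algebra.smul_def, mul_assoc]
  · intro f hf hnot
    have : ¬ isSSYT n (List.ofFn f) := by
      intro hss
      apply hnot
      rw [Finset.mem_filter]
      exact ⟨Finset.mem_univ _, card f hf, hss⟩
    rw [psiT, if_neg this, map_zero, zero_mul, zero_mul]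

end HLHecke
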